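/- Define N(V^+; X) = Σ 1/#Stab_{GL₂(ℤ)}(f) over a set of representatives f of the GL₂(ℤ)-orbits of irreducible integral binary cubic forms with 0 < Disc(f) < X, and N(V^-; X) the analogous sum over orbits with −X < Disc(f) < 0. Then as X → ∞, N(V^+; X) = (π²/72)·X + o(X) and N(V^-; X) = (π²/24)·X + o(X). -/

import Mathlib

open Matrix Filter Topology
open scoped Classical

/-- An integral binary cubic form `a u³ + b u² v + c u v² + d v³`. -/
structure BCF where
  a : ℤ
  b : ℤ
  c : ℤ
  d : ℤ

/-- The discriminant of a binary cubic form. -/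
def BCF.disc (f : BCF) : ℤ :=
  f.b ^ 2 * f.c ^ 2 - 4 * f.a * f.c ^ 3 - 4 * f.b ^ 3 * f.d - 27 * f.a ^ 2 * f.d ^ 2
    + 18 * f.a * f.b * f.c * f.d

/-- The binary cubic form as a polynomial in two variables over `ℚ`. -/
noncomputable def BCF.toMv (f : BCF) : MvPolynomial (Fin 2) ℚ :=
  MvPolynomial.C (f.a : ℚ) * MvPolynomial.X 0 ^ 3
    + MvPolynomial.C (f.b : ℚ) * MvPolynomial.X 0 ^ 2 * MvPolynomial.X 1
    + MvPolynomial.C (f.c : ℚ) * MvPolynomial.X 0 * MvPolynomial.X 1 ^ 2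
    + MvPolynomial.C (f.d : ℚ) * MvPolynomial.X 1 ^ 3

/-- The action of `GL₂(ℤ)` on binary cubic forms:
`(γ · f)(u, v) = (det γ)⁻¹ · f((u, v) · γ)`, written out on coefficients. -/
noncomputable def bcfSMul (γ : GL (Fin 2) ℤ) (f : BCF) : BCF where
  a := ((Matrix.GeneralLinearGroup.det γ)⁻¹ : ℤˣ) *
    (f.a * ((γ : Matrix (Fin 2) (Fin 2) ℤ) 0 0) ^ 3
      + f.b * ((γ : Matrix (Fin 2) (Fin 2) ℤ) 0 0) ^ 2 * ((γ : Matrix (Fin 2) (Fin 2) ℤ) 0 1)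
      + f.c * ((γ : Matrix (Fin 2) (Fin 2) ℤ) 0 0) * ((γ : Matrix (Fin 2) (Fin 2) ℤ) 0 1) ^ 2
      + f.d * ((γ : Matrix (Fin 2) (Fin 2) ℤ) 0 1) ^ 3)
  b := ((Matrix.GeneralLinearGroup.det γ)⁻¹ : ℤˣ) *
    (3 * f.a * ((γ : Matrix (Fin 2) (Fin 2) ℤ) 0 0) ^ 2 * ((γ : Matrix (Fin 2) (Fin 2) ℤ) 1 0)
      + f.b * (((γ : Matrix (Fin 2) (Fin 2) ℤ) 0 0) ^ 2 * ((γ : Matrix (Fin 2) (Fin 2) ℤ) 1 1)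
        + 2 * ((γ : Matrix (Fin 2) (Fin 2) ℤ) 0 0) * ((γ : Matrix (Fin 2) (Fin 2) ℤ) 0 1)
          * ((γ : Matrix (Fin 2) (Fin 2) ℤ) 1 0))
      + f.c * (((γ : Matrix (Fin 2) (Fin 2) ℤ) 0 1) ^ 2 * ((γ : Matrix (Fin 2) (Fin 2) ℤ) 1 0)
        + 2 * ((γ : Matrix (Fin 2) (Fin 2) ℤ) 0 0) * ((γ : Matrix (Fin 2) (Fin 2) ℤ) 0 1)
          * ((γ : Matrix (Fin 2) (Fin 2) ℤ) 1 1))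
      + 3 * f.d * ((γ : Matrix (Fin 2) (Fin 2) ℤ) 0 1) ^ 2 * ((γ : Matrix (Fin 2) (Fin 2) ℤ) 1 1))
  c := ((Matrix.GeneralLinearGroup.det γ)⁻¹ : ℤˣ) *
    (3 * f.a * ((γ : Matrix (Fin 2) (Fin 2) ℤ) 0 0) * ((γ : Matrix (Fin 2) (Fin 2) ℤ) 1 0) ^ 2
      + f.b * (2 * ((γ : Matrix (Fin 2) (Fin 2) ℤ) 0 0) * ((γ : Matrix (Fin 2) (Fin 2) ℤ) 1 0)
          * ((γ : Matrix (Fin 2) (Fin 2) ℤ) 1 1)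
        + ((γ : Matrix (Fin 2) (Fin 2) ℤ) 0 1) * ((γ : Matrix (Fin 2) (Fin 2) ℤ) 1 0) ^ 2)
      + f.c * (((γ : Matrix (Fin 2) (Fin 2) ℤ) 0 0) * ((γ : Matrix (Fin 2) (Fin 2) ℤ) 1 1) ^ 2
        + 2 * ((γ : Matrix (Fin 2) (Fin 2) ℤ) 0 1) * ((γ : Matrix (Fin 2) (Fin 2) ℤ) 1 0)
          * ((γ : Matrix (Fin 2) (Fin 2) ℤ) 1 1))
      + 3 * f.d * ((γ : Matrix (Fin 2) (Fin 2) ℤ) 0 1) * ((γ : Matrix (Fin 2) (Fin 2) ℤ) 1 1) ^ 2)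
  d := ((Matrix.GeneralLinearGroup.det γ)⁻¹ : ℤˣ) *
    (f.a * ((γ : Matrix (Fin 2) (Fin 2) ℤ) 1 0) ^ 3
      + f.b * ((γ : Matrix (Fin 2) (Fin 2) ℤ) 1 0) ^ 2 * ((γ : Matrix (Fin 2) (Fin 2) ℤ) 1 1)
      + f.c * ((γ : Matrix (Fin 2) (Fin 2) ℤ) 1 0) * ((γ : Matrix (Fin 2) (Fin 2) ℤ) 1 1) ^ 2
      + f.d * ((γ : Matrix (Fin 2) (Fin 2) ℤ) 1 1) ^ 3)

noncomputable instance : MulAction (GL (Fin 2) ℤ) BCF where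
  smul := bcfSMul
  one_smul f := by
    show bcfSMul 1 f = f
    obtain ⟨a, b, c, d⟩ := f
    simp [bcfSMul, Matrix.one_apply]
  mul_smul γ δ f := by
    show bcfSMul (γ * δ) f = bcfSMul γ (bcfSMul δ f)
    obtain ⟨a, b, c, d⟩ := f
    simp only [bcfSMul, Units.val_mul, Matrix.mul_apply, Fin.sum_univ_two, _root_.map_mul,
      mul_inv, Units.val_mul]
    simp only [BCF.mk.injEq]
    refine ⟨?_, ?_, ?_, ?_⟩ <;> ring

/-- `N(V^±; X)`-type counting function: the sum of `1/#Stab(f)` over a set of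
representatives `f` of the `GL₂(ℤ)`-orbits of irreducible integral binary cubic forms
whose discriminant satisfies `P`. -/
noncomputable def NV (P : ℤ → Prop) : ℝ :=
  ∑' C : Quotient (MulAction.orbitRel (GL (Fin 2) ℤ) BCF),
    if Irreducible (Quotient.out C).toMv ∧ P (Quotient.out C).disc then
      ((Nat.card (MulAction.stabilizer (GL (Fin 2) ℤ) (Quotient.out C)) : ℝ))⁻¹
    else 0

namespace BCF

/-- The value of a binary cubic form at an integral point. -/
def eval (f : BCF) (r s : ℤ) : ℤ :=
  f.a * r ^ 3 + f.b * r ^ 2 * s + f.c * r * s ^ 2 + f.d * s ^ 3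

/-- A form is anisotropic if it has no nontrivial integral zero. -/
def Aniso (f : BCF) : Prop := ∀ r s : ℤ, f.eval r s = 0 → r = 0 ∧ s = 0

theorem smul_def (γ : GL (Fin 2) ℤ) (f : BCF) : γ • f = bcfSMul γ f := rfl

theorem det_eq (γ : GL (Fin 2) ℤ) :
    ((Matrix.GeneralLinearGroup.det γ : ℤˣ) : ℤ) = γ 0 0 * γ 1 1 - γ 0 1 * γ 1 0 := by
  rw [Matrix.GeneralLinearGroup.val_det_apply, Matrix.det_fin_two]

theorem det_mul_det (γ : GL (Fin 2) ℤ) :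
    (γ 0 0 * γ 1 1 - γ 0 1 * γ 1 0) * (γ 0 0 * γ 1 1 - γ 0 1 * γ 1 0) = (1 : ℤ) := by
  rw [← det_eq, ← Units.val_mul, Int.units_mul_self, Units.val_one]

theorem det_inv_eq (γ : GL (Fin 2) ℤ) :
    (((Matrix.GeneralLinearGroup.det γ)⁻¹ : ℤˣ) : ℤ) = γ 0 0 * γ 1 1 - γ 0 1 * γ 1 0 := by
  rw [Int.units_inv_eq_self, det_eq]

theorem eval_smul (γ : GL (Fin 2) ℤ) (f : BCF) (r s : ℤ) :
    (γ • f).eval r s = (γ 0 0 * γ 1 1 - γ 0 1 * γ 1 0) *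
      f.eval (r * γ 0 0 + s * γ 1 0) (r * γ 0 1 + s * γ 1 1) := by
  rw [smul_def, ← det_inv_eq]
  simp only [bcfSMul, eval]
  ring

theorem disc_smul (γ : GL (Fin 2) ℤ) (f : BCF) : (γ • f).disc = f.disc := by
  have h := det_mul_det γ
  set e := γ 0 0 * γ 1 1 - γ 0 1 * γ 1 0 with he
  have h10 : e ^ 10 = 1 := by
    calc e ^ 10 = (e * e) ^ 5 := by ring
      _ = 1 := by rw [h]; norm_num
  have : (γ • f).disc = e ^ 10 * f.disc := by
    rw [smul_def]
    simp only [bcfSMul, disc, det_inv_eq]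
    rw [← he]
    rw [show e ^ 10 = e ^ 4 * (γ 0 0 * γ 1 1 - γ 0 1 * γ 1 0) ^ 6 by rw [← he]; ring]
    ring
  rw [this, h10, one_mul]

theorem Aniso.smul {f : BCF} (hf : f.Aniso) (γ : GL (Fin 2) ℤ) : (γ • f).Aniso := by
  intro r s h
  rw [eval_smul] at h
  have hd := det_mul_det γ
  have hne : γ 0 0 * γ 1 1 - γ 0 1 * γ 1 0 ≠ 0 := by
    intro h0
    rw [h0] at hd
    exact absurd hd (by norm_num)
  obtain ⟨h1, h2⟩ := hf _ _ ((mul_eq_zero.1 h).resolve_left hne)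
  constructor
  · refine (mul_eq_zero.1 (?_ : (γ 0 0 * γ 1 1 - γ 0 1 * γ 1 0) * r = 0)).resolve_left hne
    linear_combination γ 1 1 * h1 - γ 1 0 * h2
  · refine (mul_eq_zero.1 (?_ : (γ 0 0 * γ 1 1 - γ 0 1 * γ 1 0) * s = 0)).resolve_left hne
    linear_combination γ 0 0 * h2 - γ 0 1 * h1

theorem Aniso.a_ne_zero {f : BCF} (hf : f.Aniso) : f.a ≠ 0 := by
  intro h
  have := hf 1 0 (by simp [eval, h])
  simp at this

theorem aniso_of_irreducible {f : BCF} (hf : Irreducible f.toMv) : f.Aniso := by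
  intro r s h
  by_contra hrs
  have hq : (f.a : ℚ) * r ^ 3 + f.b * r ^ 2 * s + f.c * r * s ^ 2 + f.d * s ^ 3 = 0 := by
    exact_mod_cast h
  have key : ∀ l q : MvPolynomial (Fin 2) ℚ, f.toMv = l * q →
      MvPolynomial.eval 0 l = 0 → MvPolynomial.eval 0 q = 0 → False := by
    intro l q hlq hl hq
    rcases hf.isUnit_or_isUnit hlq with hu | hu
    · exact (hl ▸ hu.map (MvPolynomial.eval (0 : Fin 2 → ℚ))).ne_zero rfl
    · exact (hq ▸ hu.map (MvPolynomial.eval (0 : Fin 2 → ℚ))).ne_zero rfl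
  by_cases hs : s = 0
  · subst hs
    have hr : (r : ℚ) ≠ 0 := by
      intro hr
      exact hrs ⟨by exact_mod_cast hr, rfl⟩
    have ha : (f.a : ℚ) = 0 := by
      have : (f.a : ℚ) * r ^ 3 = 0 := by simpa using hq
      simpa [hr] using this
    refine key (MvPolynomial.X 1) (MvPolynomial.C (f.b : ℚ) * MvPolynomial.X 0 ^ 2
      + MvPolynomial.C (f.c : ℚ) * MvPolynomial.X 0 * MvPolynomial.X 1
      + MvPolynomial.C (f.d : ℚ) * MvPolynomial.X 1 ^ 2) ?_ (by simp) (by simp)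
    rw [toMv, ha, map_zero]
    ring
  · have hs' : (s : ℚ) ≠ 0 := by exact_mod_cast hs
    set t : ℚ := r / s with ht
    have hd : (f.d : ℚ) = -(f.a * t ^ 3 + f.b * t ^ 2 + f.c * t) := by
      rw [ht]
      field_simp
      linear_combination hq
    refine key (MvPolynomial.X 0 - MvPolynomial.C t * MvPolynomial.X 1)
      (MvPolynomial.C (f.a : ℚ) * MvPolynomial.X 0 ^ 2
      + MvPolynomial.C (f.b + f.a * t : ℚ) * MvPolynomial.X 0 * MvPolynomial.X 1
      + MvPolynomial.C (f.c + f.b * t + f.a * t ^ 2 : ℚ) * MvPolynomial.X 1 ^ 2) ?_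
      (by simp) (by simp)
    rw [toMv, hd]
    simp only [map_neg, map_add, map_mul, map_pow]
    ring

/-- The dehomogenisation `f(t, 1)`. -/
theorem aeval_toMv (f : BCF) :
    MvPolynomial.aeval ![(Polynomial.X : Polynomial ℚ), 1] f.toMv =
      Polynomial.C (f.a : ℚ) * Polynomial.X ^ 3 + Polynomial.C (f.b : ℚ) * Polynomial.X ^ 2
        + Polynomial.C (f.c : ℚ) * Polynomial.X + Polynomial.C (f.d : ℚ) := by
  simp [toMv]

theorem totalDegree_toMv_le (f : BCF) : f.toMv.totalDegree ≤ 3 := by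
  have h : f.toMv.IsHomogeneous 3 := by
    unfold toMv
    refine MvPolynomial.IsHomogeneous.add (.add (.add ?_ ?_) ?_) ?_
    · simpa using (MvPolynomial.isHomogeneous_C (Fin 2) (f.a : ℚ)).mul
        ((MvPolynomial.isHomogeneous_X ℚ (0 : Fin 2)).pow 3)
    · simpa using ((MvPolynomial.isHomogeneous_C (Fin 2) (f.b : ℚ)).mul
        ((MvPolynomial.isHomogeneous_X ℚ (0 : Fin 2)).pow 2)).mul
          (MvPolynomial.isHomogeneous_X ℚ (1 : Fin 2))
    · simpa using ((MvPolynomial.isHomogeneous_C (Fin 2) (f.c : ℚ)).mul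
        (MvPolynomial.isHomogeneous_X ℚ (0 : Fin 2))).mul
          ((MvPolynomial.isHomogeneous_X ℚ (1 : Fin 2)).pow 2)
    · simpa using (MvPolynomial.isHomogeneous_C (Fin 2) (f.d : ℚ)).mul
        ((MvPolynomial.isHomogeneous_X ℚ (1 : Fin 2)).pow 3)
  exact h.totalDegree_le

theorem irreducible_of_aniso {f : BCF} (hf : f.Aniso) : Irreducible f.toMv := by
  have ha : (f.a : ℚ) ≠ 0 := by exact_mod_cast hf.a_ne_zero
  set φ := MvPolynomial.aeval (R := ℚ) ![(Polynomial.X : Polynomial ℚ), 1] with hφ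
  have hdeg : (φ f.toMv).natDegree = 3 := by
    rw [hφ, aeval_toMv]
    exact Polynomial.natDegree_cubic ha
  have hφle : ∀ g : MvPolynomial (Fin 2) ℚ, (φ g).natDegree ≤ g.totalDegree := by
    intro g
    have := MvPolynomial.aeval_natDegree_le g le_rfl
      ![(Polynomial.X : Polynomial ℚ), 1] (n := 1) (by intro i; fin_cases i <;> simp)
    simpa using this
  have hne : f.toMv ≠ 0 := by
    intro h
    rw [h] at hdeg
    simp at hdeg
  have hroot : ∀ t : ℚ, (φ f.toMv).IsRoot t → False := by
    intro t ht
    rw [hφ, aeval_toMv] at ht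
    have ht' : (f.a : ℚ) * t ^ 3 + f.b * t ^ 2 + f.c * t + f.d = 0 := by simpa using ht
    have hden : (t.den : ℚ) ≠ 0 := by exact_mod_cast t.den_ne_zero
    have htd : t * t.den = t.num := Rat.mul_den_eq_num t
    have : f.eval t.num t.den = 0 := by
      have : (f.eval t.num t.den : ℚ) = 0 := by
        simp only [eval]
        push_cast
        rw [← htd]
        linear_combination (t.den : ℚ) ^ 3 * ht'
      exact_mod_cast this
    have := (hf _ _ this).2
    exact t.den_ne_zero (by exact_mod_cast this)
  refine ⟨?_, ?_⟩
  · intro hu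
    have := Polynomial.natDegree_eq_zero_of_isUnit (hu.map φ)
    omega
  · intro g h hgh
    have hg : g ≠ 0 := by rintro rfl; simp [hgh] at hne
    have hh : h ≠ 0 := by rintro rfl; simp [hgh] at hne
    have htot : g.totalDegree + h.totalDegree ≤ 3 := by
      rw [← MvPolynomial.totalDegree_mul_of_isDomain hg hh, ← hgh]
      exact totalDegree_toMv_le f
    have hφgh : φ f.toMv = φ g * φ h := by rw [hgh, map_mul]
    have hφne : φ g * φ h ≠ 0 := by
      rw [← hφgh]
      intro h0
      rw [h0] at hdeg
      simp at hdeg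
    have hsum : (φ g).natDegree + (φ h).natDegree = 3 := by
      rw [← Polynomial.natDegree_mul (left_ne_zero_of_mul hφne) (right_ne_zero_of_mul hφne),
        ← hφgh, hdeg]
    have hunit : ∀ g : MvPolynomial (Fin 2) ℚ, g ≠ 0 → g.totalDegree = 0 → IsUnit g := by
      intro g hg h0
      rw [MvPolynomial.totalDegree_eq_zero_iff_eq_C] at h0
      rw [h0]
      refine (isUnit_iff_ne_zero.2 ?_).map MvPolynomial.C
      intro h1
      rw [h1, map_zero] at h0
      exact hg h0
    have hlin : ∀ p q : Polynomial ℚ, φ f.toMv = p * q → p.natDegree = 1 → False := by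
      intro p q hpq hp
      obtain ⟨t, ht⟩ := Polynomial.exists_root_of_degree_eq_one
        ((Polynomial.degree_eq_iff_natDegree_eq_of_pos one_pos).2 hp)
      exact hroot t (by rw [hpq]; exact Polynomial.root_mul_right_of_isRoot q ht)
    have h1 := hφle g
    have h2 := hφle h
    have hc : g.totalDegree = 0 ∨ h.totalDegree = 0 ∨ (φ g).natDegree = 1 ∨
        (φ h).natDegree = 1 := by omega
    rcases hc with h0 | h0 | h0 | h0
    · exact .inl (hunit g hg h0)
    · exact .inr (hunit h hh h0)
    · exact (hlin _ _ hφgh h0).elim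
    · exact (hlin _ _ (hφgh.trans (mul_comm _ _)) h0).elim

theorem irreducible_iff_aniso (f : BCF) : Irreducible f.toMv ↔ f.Aniso :=
  ⟨aniso_of_irreducible, irreducible_of_aniso⟩

end BCF

/-- The set of `GL₂(ℤ)`-classes of integral binary cubic forms. -/
abbrev BCFClass := Quotient (MulAction.orbitRel (GL (Fin 2) ℤ) BCF)

/-- The weighted contribution of a class to `NV P`. -/
noncomputable def classWeight (P : ℤ → Prop) (C : BCFClass) : ℝ :=
  if Irreducible (Quotient.out C).toMv ∧ P (Quotient.out C).disc then
    ((Nat.card (MulAction.stabilizer (GL (Fin 2) ℤ) (Quotient.out C)) : ℝ))⁻¹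
  else 0

/-- The members of `S` lying in the class `C`. -/
noncomputable def classFiber (S : Finset BCF) (C : BCFClass) : Finset BCF :=
  S.filter fun f => (Quotient.mk _ f : BCFClass) = C

theorem exists_smul_out (f : BCF) :
    ∃ γ : GL (Fin 2) ℤ, γ • (Quotient.out (Quotient.mk _ f : BCFClass)) = f := by
  have h : (Quotient.mk _ (Quotient.out (Quotient.mk _ f : BCFClass)) : BCFClass) =
    Quotient.mk _ f := Quotient.out_eq _
  have h2 := Quotient.exact h.symm
  exact h2

theorem mk_smul (γ : GL (Fin 2) ℤ) (f : BCF) :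
    (Quotient.mk _ (γ • f) : BCFClass) = Quotient.mk _ f :=
  Quotient.sound ⟨γ, rfl⟩

theorem classWeight_le {P : ℤ → Prop} {Γ : Finset (GL (Fin 2) ℤ)} (hΓ : Γ.Nonempty)
    {S : Finset BCF}
    (hex : ∀ f : BCF, f.Aniso → P f.disc → ∃ γ : GL (Fin 2) ℤ, γ • f ∈ S)
    (hinv : ∀ f ∈ S, ∀ γ ∈ Γ, γ • f ∈ S) (C : BCFClass) :
    classWeight P C ≤ (classFiber S C).card / Γ.card := by
  unfold classWeight
  split_ifs with h
  swap
  · positivity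
  set f := Quotient.out C with hf
  obtain ⟨γ₀, hγ₀⟩ := hex f ((BCF.irreducible_iff_aniso f).1 h.1) h.2
  by_cases hfin : Finite (MulAction.stabilizer (GL (Fin 2) ℤ) f)
  swap
  · rw [Nat.card_eq_zero.2 (.inr (not_finite_iff_infinite.1 hfin))]
    simp only [CharP.cast_eq_zero, _root_.inv_zero]
    positivity
  have hτ : ∀ g : BCF, ∃ τ : GL (Fin 2) ℤ, g ∈ MulAction.orbit (GL (Fin 2) ℤ) f → τ • f = g := by
    intro g
    by_cases hg : g ∈ MulAction.orbit (GL (Fin 2) ℤ) f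
    · obtain ⟨τ, hτ⟩ := hg
      exact ⟨τ, fun _ => hτ⟩
    · exact ⟨1, fun h => absurd h hg⟩
  choose τ hτ using hτ
  let φ : Γ → classFiber S C × MulAction.stabilizer (GL (Fin 2) ℤ) f := fun γ =>
    (⟨(γ.1 * γ₀) • f, by
        rw [classFiber, Finset.mem_filter, mul_smul]
        refine ⟨hinv _ hγ₀ _ γ.2, ?_⟩
        rw [mk_smul, mk_smul, hf, Quotient.out_eq]⟩,
      ⟨(τ ((γ.1 * γ₀) • f))⁻¹ * (γ.1 * γ₀), by
        rw [MulAction.mem_stabilizer_iff, mul_smul, inv_smul_eq_iff]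
        exact (hτ _ ⟨_, rfl⟩).symm⟩)
  have hφ : Function.Injective φ := by
    intro γ δ h
    simp only [φ, Prod.mk.injEq, Subtype.mk.injEq] at h
    rw [h.1] at h
    exact Subtype.ext (mul_right_cancel (mul_left_cancel h.2))
  have hcard := Nat.card_le_card_of_injective φ hφ
  rw [Nat.card_prod, Nat.card_eq_finsetCard, Nat.card_eq_finsetCard] at hcard
  have hpos : 0 < Nat.card (MulAction.stabilizer (GL (Fin 2) ℤ) f) := Nat.card_pos
  have hΓ' : 0 < Γ.card := hΓ.card_pos
  rw [inv_eq_one_div, div_le_div_iff₀ (by exact_mod_cast hpos) (by exact_mod_cast hΓ'), one_mul]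
  exact_mod_cast hcard

theorem card_classFiber_le {P : ℤ → Prop} {Γ : Finset (GL (Fin 2) ℤ)} (hΓ : Γ.Nonempty)
    {S : Finset BCF} (hS : ∀ f ∈ S, f.Aniso ∧ P f.disc)
    (huniq : ∀ f ∈ S, ∀ γ : GL (Fin 2) ℤ, γ • f ∈ S → γ ∈ Γ) (C : BCFClass) :
    (classFiber S C).card / Γ.card ≤ classWeight P C := by
  unfold classWeight
  have hΓ' : 0 < Γ.card := hΓ.card_pos
  rcases (classFiber S C).eq_empty_or_nonempty with he | ⟨f₀, hf₀⟩
  · rw [he]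
    simp only [Finset.card_empty, CharP.cast_eq_zero, zero_div]
    split_ifs <;> positivity
  rw [classFiber, Finset.mem_filter] at hf₀
  obtain ⟨hf₀S, hf₀C⟩ := hf₀
  set f := Quotient.out C with hf
  have hmem : ∀ g ∈ classFiber S C, ∃ τ : GL (Fin 2) ℤ, τ • f₀ = g := by
    intro g hg
    rw [classFiber, Finset.mem_filter] at hg
    exact Quotient.exact (hg.2.trans hf₀C.symm)
  obtain ⟨ρ, hρ⟩ : ∃ ρ : GL (Fin 2) ℤ, ρ • f = f₀ := by
    have := exists_smul_out f₀
    rwa [hf₀C] at this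
  have hfρ : f = ρ⁻¹ • f₀ := by rw [← hρ, inv_smul_smul]
  have hcond : Irreducible f.toMv ∧ P f.disc := by
    rw [BCF.irreducible_iff_aniso, hfρ, BCF.disc_smul]
    exact ⟨(hS _ hf₀S).1.smul _, (hS _ hf₀S).2⟩
  rw [if_pos hcond]
  choose! τ hτ using hmem
  let φ : classFiber S C × MulAction.stabilizer (GL (Fin 2) ℤ) f → Γ := fun x =>
    ⟨τ x.1 * (ρ * x.2 * ρ⁻¹), by
      refine huniq f₀ hf₀S _ ?_
      have h1 : (x.2 : GL (Fin 2) ℤ) • f = f := x.2.2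
      rw [mul_smul, mul_smul, mul_smul, ← hfρ, h1, hρ, hτ _ x.1.2]
      exact (Finset.mem_filter.1 x.1.2).1⟩
  have hφ : Function.Injective φ := by
    rintro ⟨x, σ⟩ ⟨y, σ'⟩ h
    simp only [φ, Subtype.mk.injEq] at h
    have hxy : (x : BCF) = y := by
      have h1 : (σ : GL (Fin 2) ℤ) • f = f := σ.2
      have h2 : (σ' : GL (Fin 2) ℤ) • f = f := σ'.2
      have := congrArg (· • f₀) h
      simp only [mul_smul] at this
      rwa [← hfρ, h1, h2, hρ, hτ _ x.2, hτ _ y.2] at this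
    rw [hxy] at h
    have h' := mul_right_cancel (mul_left_cancel h)
    exact Prod.ext (Subtype.ext hxy) (Subtype.ext (mul_left_cancel h'))
  have hne : Nonempty (classFiber S C) := ⟨⟨f₀, Finset.mem_filter.2 ⟨hf₀S, hf₀C⟩⟩⟩
  have hfin : Finite (MulAction.stabilizer (GL (Fin 2) ℤ) f) := by
    have := Finite.of_injective φ hφ
    exact Finite.prod_right (classFiber S C)
  have hcard := Nat.card_le_card_of_injective φ hφ
  rw [Nat.card_prod, Nat.card_eq_finsetCard, Nat.card_eq_finsetCard] at hcard
  have hpos : 0 < Nat.card (MulAction.stabilizer (GL (Fin 2) ℤ) f) := Nat.card_pos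
  rw [inv_eq_one_div, div_le_div_iff₀ (by exact_mod_cast hΓ') (by exact_mod_cast hpos), one_mul]
  exact_mod_cast hcard

/-- The classes met by a finite set of forms. -/
noncomputable def classesOf (S : Finset BCF) : Finset BCFClass :=
  S.image fun f => (Quotient.mk _ f : BCFClass)

theorem sum_card_classFiber (S : Finset BCF) :
    ∑ C ∈ classesOf S, ((classFiber S C).card : ℝ) = S.card := by
  rw [← Nat.cast_sum]
  congr 1
  exact (Finset.card_eq_sum_card_fiberwise fun f hf => Finset.mem_image_of_mem _ hf).symm

theorem classFiber_eq_empty {S : Finset BCF} {C : BCFClass} (hC : C ∉ classesOf S) :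
    classFiber S C = ∅ := by
  rw [classFiber, Finset.filter_eq_empty_iff]
  intro f hf h
  exact hC (Finset.mem_image.2 ⟨f, hf, h⟩)

theorem classWeight_nonneg (P : ℤ → Prop) (C : BCFClass) : 0 ≤ classWeight P C := by
  unfold classWeight
  split_ifs <;> positivity

/-- If `S` meets every class counted by `NV P` and is stable under a set `Γ` of matrices, then
`NV P ≤ #S / #Γ`. -/
theorem NV_le {P : ℤ → Prop} {Γ : Finset (GL (Fin 2) ℤ)} (hΓ : Γ.Nonempty) {S : Finset BCF}
    (hex : ∀ f : BCF, f.Aniso → P f.disc → ∃ γ : GL (Fin 2) ℤ, γ • f ∈ S)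
    (hinv : ∀ f ∈ S, ∀ γ ∈ Γ, γ • f ∈ S) : NV P ≤ S.card / Γ.card := by
  have hle := classWeight_le (P := P) hΓ hex hinv
  have hzero : ∀ C ∉ classesOf S, classWeight P C = 0 := by
    intro C hC
    refine le_antisymm ?_ (classWeight_nonneg P C)
    simpa [classFiber_eq_empty hC] using hle C
  change ∑' C : BCFClass, classWeight P C ≤ _
  rw [tsum_eq_sum hzero, ← sum_card_classFiber S, Finset.sum_div]
  exact Finset.sum_le_sum fun C _ => hle C

/-- If two members of `S'` can only be equivalent through a matrix in `Γ`, then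
`#S' / #Γ ≤ NV P`. The set `S` witnesses that only finitely many classes contribute to `NV P`. -/
theorem le_NV {P : ℤ → Prop} {Γ : Finset (GL (Fin 2) ℤ)} (hΓ : Γ.Nonempty) {S S' : Finset BCF}
    (hex : ∀ f : BCF, f.Aniso → P f.disc → ∃ γ : GL (Fin 2) ℤ, γ • f ∈ S)
    (hinv : ∀ f ∈ S, ∀ γ ∈ Γ, γ • f ∈ S) (hS' : ∀ f ∈ S', f.Aniso ∧ P f.disc)
    (huniq : ∀ f ∈ S', ∀ γ : GL (Fin 2) ℤ, γ • f ∈ S' → γ ∈ Γ) : S'.card / Γ.card ≤ NV P := by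
  have hle := classWeight_le (P := P) hΓ hex hinv
  have hzero : ∀ C ∉ classesOf S, classWeight P C = 0 := by
    intro C hC
    refine le_antisymm ?_ (classWeight_nonneg P C)
    simpa [classFiber_eq_empty hC] using hle C
  have hsum : Summable (classWeight P) := summable_of_ne_finset_zero hzero
  change _ ≤ ∑' C : BCFClass, classWeight P C
  rw [← sum_card_classFiber S', Finset.sum_div]
  exact (Finset.sum_le_sum fun C _ => card_classFiber_le hΓ hS' huniq C).trans
    (hsum.sum_le_tsum _ fun C _ => classWeight_nonneg P C)

/-- The coefficient vector of an integral form. -/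
def BCF.vec (f : BCF) : Fin 4 → ℝ := ![f.a, f.b, f.c, f.d]

/-- The discriminant of a real binary cubic form, given by its coefficient vector. -/
def realDisc (v : Fin 4 → ℝ) : ℝ :=
  v 1 ^ 2 * v 2 ^ 2 - 4 * v 0 * v 2 ^ 3 - 4 * v 1 ^ 3 * v 3 - 27 * v 0 ^ 2 * v 3 ^ 2
    + 18 * v 0 * v 1 * v 2 * v 3

theorem realDisc_vec (f : BCF) : realDisc f.vec = f.disc := by
  simp [realDisc, BCF.vec, BCF.disc]

/-- Coefficient of `q y u² v` in `cubicParam`. -/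
def cB : Bool → ℝ
  | true => 3
  | false => 1

/-- Coefficient of `p y² u v²` in `cubicParam`. -/
def cC : Bool → ℝ
  | true => -3
  | false => 1

/-- Coefficient of `q y³ v³` in `cubicParam`. -/
def cD : Bool → ℝ
  | true => -1
  | false => 1

/-- The constant in the discriminant of `cubicParam`. -/
def cS : Bool → ℝ
  | true => 108
  | false => -4

/-- The constant in the Jacobian of `cubicParam`. -/
def cJ : Bool → ℝ
  | true => 36
  | false => 4

/-- Parametrisation of real binary cubic forms by `w = (p, q, x, y)`, where `z = x + i y` is the
covariant point of the form. For `s = true` it is `Re ((p + i q) (u - z v)³)`, with positive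
discriminant; for `s = false` it is `(p (u - x v) + q y v) |u - z v|²`, with negative
discriminant. -/
def cubicParam (s : Bool) (w : Fin 4 → ℝ) : Fin 4 → ℝ :=
  ![w 0,
    -3 * w 2 * w 0 + cB s * w 1 * w 3,
    3 * w 2 ^ 2 * w 0 - 2 * w 2 * cB s * w 1 * w 3 + cC s * w 0 * w 3 ^ 2,
    -w 2 ^ 3 * w 0 + w 2 ^ 2 * cB s * w 1 * w 3 - w 2 * cC s * w 0 * w 3 ^ 2
      + cD s * w 1 * w 3 ^ 3]

theorem cB_pos (s : Bool) : 0 < cB s := by cases s <;> simp [cB]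

theorem realDisc_cubicParam (s : Bool) (w : Fin 4 → ℝ) :
    realDisc (cubicParam s w) = cS s * w 3 ^ 6 * (w 0 ^ 2 + w 1 ^ 2) ^ 2 := by
  cases s <;> simp [realDisc, cubicParam, cB, cC, cD, cS] <;> ring

/-- The form with coefficient vector `v` has covariant point `x + i y` with `N = x² + y²`. -/
def IsCovariant (s : Bool) (v : Fin 4 → ℝ) (x N : ℝ) : Prop :=
  match s with
  | true => v 2 = -2 * v 1 * x - 3 * v 0 * N ∧ 3 * v 3 = -v 1 * N - 2 * v 2 * x
  | false => v 2 = v 0 * N - 2 * x * (v 1 + 2 * x * v 0) ∧ v 3 = (v 1 + 2 * x * v 0) * N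

theorem isCovariant_cubicParam (s : Bool) (w : Fin 4 → ℝ) :
    IsCovariant s (cubicParam s w) (w 2) (w 2 ^ 2 + w 3 ^ 2) := by
  cases s <;> simp [IsCovariant, cubicParam, cB, cC, cD] <;> constructor <;> ring

theorem IsCovariant.eq_cubicParam {s : Bool} {v : Fin 4 → ℝ} {x y : ℝ} (hy : 0 < y)
    (h : IsCovariant s v x (x ^ 2 + y ^ 2)) :
    v = cubicParam s ![v 0, (v 1 + 3 * x * v 0) / (cB s * y), x, y] := by
  cases s
  · obtain ⟨h1, h2⟩ := h
    ext i
    fin_cases i <;> simp [cubicParam, cB, cC, cD]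
    · field_simp; ring
    · field_simp; linear_combination h1
    · field_simp; linear_combination h2
  · obtain ⟨h1, h2⟩ := h
    ext i
    fin_cases i <;> simp [cubicParam, cB, cC, cD]
    · field_simp; ring
    · field_simp; linear_combination h1
    · field_simp; linear_combination h2 - 2 * x * h1

theorem IsCovariant.unique {s : Bool} {v : Fin 4 → ℝ} {x y x' y' : ℝ} (hy : 0 < y) (hy' : 0 < y')
    (hd : realDisc v ≠ 0) (h : IsCovariant s v x (x ^ 2 + y ^ 2))
    (h' : IsCovariant s v x' (x' ^ 2 + y' ^ 2)) : x = x' ∧ y = y' := by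
  suffices H : x = x' ∧ x ^ 2 + y ^ 2 = x' ^ 2 + y' ^ 2 by
    refine ⟨H.1, ?_⟩
    have h2 := H.2
    rw [H.1] at h2
    exact (pow_left_inj₀ hy.le hy'.le two_ne_zero).1 (by linarith)
  have hv := h.eq_cubicParam hy
  rw [hv, realDisc_cubicParam] at hd
  simp only [Matrix.cons_val_zero, Matrix.cons_val_one] at hd
  have hpq : ((v 0) ^ 2 + ((v 1 + 3 * x * v 0) / (cB s * y)) ^ 2) ≠ 0 := by
    intro h0
    rw [h0] at hd
    simp at hd
  cases s
  · obtain ⟨h1, h2⟩ := h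
    obtain ⟨h1', h2'⟩ := h'
    by_cases ha : v 0 = 0
    · have hb : v 1 ≠ 0 := by
        intro hb
        rw [ha, hb] at hpq
        simp at hpq
      rw [ha] at h1 h2 h1' h2'
      have hx : x = x' := by
        have : v 1 * (x - x') = 0 := by linear_combination (h1 - h1') / 2
        linarith [(mul_eq_zero.1 this).resolve_left hb]
      refine ⟨hx, ?_⟩
      have : v 1 * ((x ^ 2 + y ^ 2) - (x' ^ 2 + y' ^ 2)) = 0 := by linear_combination h2' - h2
      linarith [(mul_eq_zero.1 this).resolve_left hb]
    · have key : (x - x') * ((v 1 + 2 * x' * v 0 + x * v 0) ^ 2 + y ^ 2 * v 0 ^ 2) = 0 := by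
        have : v 0 * ((x - x') *
            ((v 1 + 2 * x' * v 0 + x * v 0) ^ 2 + y ^ 2 * v 0 ^ 2)) = 0 := by
          linear_combination (v 0 ^ 2 / 2) * (h2' - h2)
            - (v 0 / 2) * (v 1 + 2 * x' * v 0) * (h1' - h1)
        exact (mul_eq_zero.1 this).resolve_left ha
      have hpos : 0 < (v 1 + 2 * x' * v 0 + x * v 0) ^ 2 + y ^ 2 * v 0 ^ 2 := by
        have : 0 < v 0 ^ 2 := by positivity
        positivity
      have hx : x = x' := by linarith [(mul_eq_zero.1 key).resolve_right hpos.ne']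
      refine ⟨hx, ?_⟩
      rw [hx] at h1 ⊢
      have : v 0 * ((x' ^ 2 + y ^ 2) - (x' ^ 2 + y' ^ 2)) = 0 := by linear_combination h1' - h1
      linarith [(mul_eq_zero.1 this).resolve_left ha]
  · have hA : v 1 ^ 2 - 3 * v 0 * v 2 ≠ 0 := by
      have : v 1 ^ 2 - 3 * v 0 * v 2 =
          9 * y ^ 2 * ((v 0) ^ 2 + ((v 1 + 3 * x * v 0) / (cB true * y)) ^ 2) := by
        simp only [cB]
        field_simp
        linear_combination (-27 * v 0) * h.1
      rw [this]
      exact mul_ne_zero (by positivity) hpq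
    obtain ⟨h1, h2⟩ := h
    obtain ⟨h1', h2'⟩ := h'
    constructor
    · have : (v 1 ^ 2 - 3 * v 0 * v 2) * (x - x') = 0 := by
        linear_combination (v 1 / 2) * (h1 - h1') - (3 * v 0 / 2) * (h2 - h2')
      linarith [(mul_eq_zero.1 this).resolve_left hA]
    · have : (v 1 ^ 2 - 3 * v 0 * v 2) * ((x ^ 2 + y ^ 2) - (x' ^ 2 + y' ^ 2)) = 0 := by
        linear_combination v 2 * (h1' - h1) - v 1 * (h2' - h2)
      linarith [(mul_eq_zero.1 this).resolve_left hA]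

theorem exists_cubic_root {a : ℝ} (ha : a ≠ 0) (b c d : ℝ) :
    ∃ t : ℝ, a * t ^ 3 + b * t ^ 2 + c * t + d = 0 := by
  have ha' : 0 < |a| := abs_pos.2 ha
  set M : ℝ := 1 + (|b| + |c| + |d|) / |a| with hM
  have hM1 : 1 ≤ M := by
    have : 0 ≤ (|b| + |c| + |d|) / |a| := by positivity
    linarith
  have hMa : |a| * (M - 1) = |b| + |c| + |d| := by
    rw [hM]; field_simp; ring
  have hbound : ∀ t : ℝ, |t| = M → |a * (b * t ^ 2 + c * t + d)| < a ^ 2 * M ^ 3 := by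
    intro t ht
    have h1 : |b * t ^ 2 + c * t + d| ≤ |b| * M ^ 2 + |c| * M + |d| := by
      refine (abs_add_three _ _ _).trans ?_
      rw [abs_mul, abs_mul, abs_pow, ht]
    have h2 : |b| * M ^ 2 + |c| * M + |d| ≤ (|b| + |c| + |d|) * M ^ 2 := by
      have : M ≤ M ^ 2 := by nlinarith
      have : (1 : ℝ) ≤ M ^ 2 := by nlinarith
      nlinarith [abs_nonneg c, abs_nonneg d]
    rw [abs_mul, ← sq_abs a]
    have h3 : |a| * |b * t ^ 2 + c * t + d| ≤ |a| * ((|b| + |c| + |d|) * M ^ 2) := by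
      gcongr
      exact h1.trans h2
    rw [← hMa] at h3
    have : 0 < |a| ^ 2 * M ^ 2 := by positivity
    nlinarith
  have hcont : Continuous fun t : ℝ => a * (a * t ^ 3 + b * t ^ 2 + c * t + d) := by fun_prop
  have hivt := intermediate_value_Icc (show -M ≤ M by linarith) hcont.continuousOn
  have hp := hbound M (abs_of_nonneg (by linarith))
  have hn := hbound (-M) (by rw [abs_neg, abs_of_nonneg (by linarith)])
  rw [abs_lt] at hp hn
  obtain ⟨t, -, ht⟩ := hivt (show (0 : ℝ) ∈ Set.Icc _ _ by constructor <;> nlinarith)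
  exact ⟨t, (mul_eq_zero.1 ht).resolve_left ha⟩

theorem exists_isCovariant {s : Bool} {v : Fin 4 → ℝ} (ha : v 0 ≠ 0)
    (hd : 0 < cS s * realDisc v) : ∃ x y : ℝ, 0 < y ∧ IsCovariant s v x (x ^ 2 + y ^ 2) := by
  cases s
  · simp only [cS] at hd
    obtain ⟨r, hr⟩ := exists_cubic_root ha (v 1) (v 2) (v 3)
    set m := v 1 + r * v 0 with hm
    set n := v 2 + r * m with hn
    have hv1 : v 1 = m - r * v 0 := by rw [hm]; ring
    have hv2 : v 2 = n - r * m := by rw [hn]; ring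
    have hv3 : v 3 = -r * n := by
      rw [hn, hm]; linear_combination hr
    have hdisc : realDisc v = (m ^ 2 - 4 * v 0 * n) * (v 0 * r ^ 2 + m * r + n) ^ 2 := by
      rw [realDisc, hv1, hv2, hv3]; ring
    have hneg : m ^ 2 - 4 * v 0 * n < 0 := by
      by_contra! h
      have : 0 ≤ realDisc v := by rw [hdisc]; positivity
      linarith
    refine ⟨-m / (2 * v 0), √(4 * v 0 * n - m ^ 2) / (2 * |v 0|),
      div_pos (Real.sqrt_pos.2 (by linarith)) (by positivity), ?_⟩
    have hN : (-m / (2 * v 0)) ^ 2 + (√(4 * v 0 * n - m ^ 2) / (2 * |v 0|)) ^ 2 = n / v 0 := by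
      rw [div_pow, div_pow, Real.sq_sqrt (by linarith), mul_pow, mul_pow, sq_abs]
      field_simp
      ring
    rw [hN]
    refine ⟨?_, ?_⟩
    · rw [hv1, hv2]; field_simp; ring
    · rw [hv1, hv3]; field_simp; ring
  · simp only [cS] at hd
    set A := v 1 ^ 2 - 3 * v 0 * v 2 with hA
    set B := v 1 * v 2 - 9 * v 0 * v 3 with hB
    set C := v 2 ^ 2 - 3 * v 1 * v 3 with hC
    have hD : 0 < realDisc v := by linarith
    have h3 : 4 * A * C - B ^ 2 = 3 * realDisc v := by
      rw [hA, hB, hC, realDisc]; ring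
    have hsyz : 4 * A ^ 3 = (2 * v 1 ^ 3 + 27 * v 0 ^ 2 * v 3 - 9 * v 0 * v 1 * v 2) ^ 2
        + 27 * v 0 ^ 2 * realDisc v := by
      rw [hA, realDisc]; ring
    have hA3 : 0 < A ^ 3 := by
      have : 0 < v 0 ^ 2 := by positivity
      have : 0 < 27 * v 0 ^ 2 * realDisc v := by positivity
      nlinarith [sq_nonneg (2 * v 1 ^ 3 + 27 * v 0 ^ 2 * v 3 - 9 * v 0 * v 1 * v 2)]
    have hApos : 0 < A := by
      by_contra! h
      have : A ^ 3 ≤ 0 := by nlinarith [sq_nonneg A]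
      linarith
    refine ⟨-B / (2 * A), √(3 * realDisc v) / (2 * A),
      div_pos (Real.sqrt_pos.2 (by linarith)) (by positivity), ?_⟩
    have hN : (-B / (2 * A)) ^ 2 + (√(3 * realDisc v) / (2 * A)) ^ 2 = C / A := by
      rw [div_pow, div_pow, Real.sq_sqrt (by linarith), ← h3]
      field_simp
      ring
    rw [hN]
    refine ⟨?_, ?_⟩
    · field_simp
      rw [hA, hB, hC]
      ring
    · field_simp
      rw [hA, hB, hC]
      ring

section Action

variable (γ : GL (Fin 2) ℤ) (x N : ℝ)

/-- The automorphy factor of the action on covariant points. -/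
def actJ : ℝ := (γ 0 0 : ℝ) ^ 2 - 2 * x * γ 0 0 * γ 0 1 + N * (γ 0 1 : ℝ) ^ 2

/-- The action on the real part of the covariant point. -/
noncomputable def actX : ℝ :=
  (x * (γ 0 0 * γ 1 1 + γ 0 1 * γ 1 0) - N * γ 0 1 * γ 1 1 - γ 0 0 * γ 1 0) / actJ γ x N

/-- The action on the squared modulus of the covariant point. -/
noncomputable def actN : ℝ :=
  (N * (γ 1 1 : ℝ) ^ 2 - 2 * x * γ 1 1 * γ 1 0 + (γ 1 0 : ℝ) ^ 2) / actJ γ x N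

end Action

theorem real_det_sq (γ : GL (Fin 2) ℤ) :
    ((γ 0 0 : ℝ) * γ 1 1 - γ 0 1 * γ 1 0) ^ 2 = 1 := by
  have := BCF.det_mul_det γ
  rw [sq]
  exact_mod_cast this

theorem actJ_pos (γ : GL (Fin 2) ℤ) {x y : ℝ} (hy : 0 < y) : 0 < actJ γ x (x ^ 2 + y ^ 2) := by
  have h : actJ γ x (x ^ 2 + y ^ 2) = ((γ 0 0 : ℝ) - x * γ 0 1) ^ 2 + (y * γ 0 1) ^ 2 := by
    rw [actJ]; ring
  rw [h]
  refine lt_of_le_of_ne (by positivity) ?_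
  intro h0
  have h1 : (y * (γ 0 1 : ℝ)) = 0 := by
    nlinarith [sq_nonneg ((γ 0 0 : ℝ) - x * γ 0 1), sq_nonneg (y * (γ 0 1 : ℝ))]
  have h2 : (γ 0 1 : ℝ) = 0 := (mul_eq_zero.1 h1).resolve_left hy.ne'
  have h3 : (γ 0 0 : ℝ) = 0 := by
    rw [h2] at h0
    nlinarith
  have := real_det_sq γ
  rw [h2, h3] at this
  norm_num at this

theorem actN_eq (γ : GL (Fin 2) ℤ) {x y : ℝ} (hy : 0 < y) :
    actN γ x (x ^ 2 + y ^ 2) =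
      actX γ x (x ^ 2 + y ^ 2) ^ 2 + (y / actJ γ x (x ^ 2 + y ^ 2)) ^ 2 := by
  have hj := actJ_pos γ (x := x) hy
  have hd := real_det_sq γ
  rw [actN, actX]
  field_simp
  rw [actJ]
  linear_combination y ^ 2 * hd

theorem IsCovariant.smul {s : Bool} {f : BCF} {x N : ℝ} (h : IsCovariant s f.vec x N)
    (γ : GL (Fin 2) ℤ) (hj : actJ γ x N ≠ 0) :
    IsCovariant s (γ • f).vec (actX γ x N) (actN γ x N) := by
  rw [BCF.smul_def]
  cases s
  · simp only [IsCovariant, BCF.vec, cons_val] at h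
    obtain ⟨hc, hd⟩ := h
    simp only [IsCovariant, BCF.vec, bcfSMul, cons_val, BCF.det_inv_eq, actX, actN]
    push_cast
    rw [hd, hc]
    constructor
    · field_simp
      rw [actJ]
      ring
    · field_simp
      rw [actJ]
      ring
  · simp only [IsCovariant, BCF.vec, cons_val] at h
    obtain ⟨hc, hd⟩ := h
    replace hd : (f.d : ℝ) = (-f.b * N - 2 * f.c * x) / 3 := by linear_combination hd / 3
    simp only [IsCovariant, BCF.vec, bcfSMul, cons_val, BCF.det_inv_eq, actX, actN]
    push_cast
    rw [hd, hc]
    constructor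
    · field_simp
      rw [actJ]
      ring
    · field_simp
      rw [actJ]
      ring

/-- The covariant point of `f` lies in the closed standard fundamental domain. -/
def Reduced (s : Bool) (f : BCF) : Prop :=
  ∃ x y : ℝ, 0 < y ∧ |x| ≤ 1 / 2 ∧ 1 ≤ x ^ 2 + y ^ 2 ∧ IsCovariant s f.vec x (x ^ 2 + y ^ 2)

/-- The covariant point of `f` lies in the open standard fundamental domain. -/
def StrictReduced (s : Bool) (f : BCF) : Prop :=
  ∃ x y : ℝ, 0 < y ∧ |x| < 1 / 2 ∧ 1 < x ^ 2 + y ^ 2 ∧ IsCovariant s f.vec x (x ^ 2 + y ^ 2)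

theorem exists_act_mem_fd (x : ℝ) {y : ℝ} (hy : 0 < y) : ∃ γ : GL (Fin 2) ℤ,
    |actX γ x (x ^ 2 + y ^ 2)| ≤ 1 / 2 ∧ 1 ≤ actN γ x (x ^ 2 + y ^ 2) := by
  let z : UpperHalfPlane := ⟨⟨x, y⟩, hy⟩
  obtain ⟨g, hg⟩ := ModularGroup.exists_smul_mem_fd z
  have hdet : g 0 0 * g 1 1 - g 0 1 * g 1 0 = 1 := by
    rw [← Matrix.det_fin_two]; exact g.2
  let γ' : Matrix.SpecialLinearGroup (Fin 2) ℤ := ⟨!![g 1 1, -g 1 0; -g 0 1, g 0 0], by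
    rw [Matrix.det_fin_two_of]; linarith⟩
  refine ⟨(γ' : GL (Fin 2) ℤ), ?_⟩
  set γ : GL (Fin 2) ℤ := (γ' : GL (Fin 2) ℤ) with hγ
  have h00 : γ 0 0 = g 1 1 := rfl
  have h01 : γ 0 1 = -g 1 0 := rfl
  have h10 : γ 1 0 = -g 0 1 := rfl
  have h11 : γ 1 1 = g 0 0 := rfl
  have hj := actJ_pos γ (x := x) hy
  have hcoe := UpperHalfPlane.coe_specialLinearGroup_apply g z
  have hz : (z : ℂ) = ⟨x, y⟩ := rfl
  have hns : Complex.normSq ((g 1 0 : ℂ) * ⟨x, y⟩ + (g 1 1 : ℂ)) =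
      actJ γ x (x ^ 2 + y ^ 2) := by
    rw [Complex.normSq_apply, actJ, h00, h01]
    simp
    ring
  obtain ⟨h1, h2⟩ := hg
  rw [hcoe, hz] at h1
  rw [← UpperHalfPlane.coe_re, hcoe, hz] at h2
  simp only [algebraMap_int_eq, eq_intCast, Complex.ofReal_intCast] at h1 h2
  constructor
  · convert h2 using 2
    rw [Complex.div_re, hns, actX, h00, h01, h10, h11, ← add_div]
    congr 1
    simp
    ring
  · convert h1 using 1
    rw [Complex.normSq_div, hns, actN, h10, h11]
    congr 1
    rw [Complex.normSq_apply]
    simp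
    ring

theorem exists_smul_reduced {s : Bool} {f : BCF} (hf : f.Aniso)
    (hd : 0 < cS s * (f.disc : ℝ)) : ∃ γ : GL (Fin 2) ℤ, Reduced s (γ • f) := by
  obtain ⟨x, y, hy, h⟩ := exists_isCovariant (s := s) (v := f.vec)
    (by simpa [BCF.vec] using hf.a_ne_zero) (by rwa [realDisc_vec])
  obtain ⟨γ, h1, h2⟩ := exists_act_mem_fd x hy
  have hj := actJ_pos γ (x := x) hy
  refine ⟨γ, actX γ x (x ^ 2 + y ^ 2), y / actJ γ x (x ^ 2 + y ^ 2), div_pos hy hj, h1, ?_, ?_⟩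
  · rwa [← actN_eq γ hy]
  · rw [← actN_eq γ hy]
    exact h.smul γ (ne_of_gt hj)

/-- The reflection `diag(1, -1)`. -/
def reflGL : GL (Fin 2) ℤ :=
  ⟨!![1, 0; 0, -1], !![1, 0; 0, -1], by simp [Matrix.one_fin_two], by simp [Matrix.one_fin_two]⟩

/-- The matrices in `GL₂(ℤ)` preserving the standard fundamental domain. -/
noncomputable def stabFD : Finset (GL (Fin 2) ℤ) := {1, -1, reflGL, -reflGL}

theorem card_stabFD : stabFD.card = 4 := by
  have h : ∀ a b : GL (Fin 2) ℤ, (a 0 0 ≠ b 0 0 ∨ a 1 1 ≠ b 1 1) → a ≠ b := by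
    rintro a b h rfl
    simp at h
  rw [stabFD, Finset.card_insert_of_notMem, Finset.card_insert_of_notMem,
    Finset.card_insert_of_notMem, Finset.card_singleton]
  · rw [Finset.mem_singleton]
    exact h _ _ (by simp [reflGL])
  · simp only [Finset.mem_insert, Finset.mem_singleton, not_or]
    exact ⟨h _ _ (by simp [reflGL]), h _ _ (by simp [reflGL])⟩
  · simp only [Finset.mem_insert, Finset.mem_singleton, not_or]
    exact ⟨h _ _ (by simp), h _ _ (by simp [reflGL]), h _ _ (by simp [reflGL])⟩

theorem mem_stabFD_iff (γ : GL (Fin 2) ℤ) : γ ∈ stabFD ↔ γ 0 1 = 0 ∧ γ 1 0 = 0 := by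
  constructor
  · intro h
    simp only [stabFD, Finset.mem_insert, Finset.mem_singleton] at h
    rcases h with rfl | rfl | rfl | rfl <;> simp [reflGL]
  · rintro ⟨h1, h2⟩
    have hd := BCF.det_mul_det γ
    rw [h1, h2, zero_mul, sub_zero] at hd
    have hu : γ 0 0 * (γ 1 1 * (γ 0 0 * γ 1 1)) = 1 := by linarith
    have hu' : γ 1 1 * (γ 0 0 * (γ 0 0 * γ 1 1)) = 1 := by linarith
    have e0 := Int.isUnit_iff.1 (IsUnit.of_mul_eq_one _ hu)
    have e1 := Int.isUnit_iff.1 (IsUnit.of_mul_eq_one _ hu')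
    have hext : ∀ δ : GL (Fin 2) ℤ, γ 0 0 = δ 0 0 → γ 1 1 = δ 1 1 → δ 0 1 = 0 → δ 1 0 = 0 →
        γ = δ := by
      intro δ a b c d
      ext i j
      fin_cases i <;> fin_cases j
      · exact a
      · exact h1.trans c.symm
      · exact h2.trans d.symm
      · exact b
    simp only [stabFD, Finset.mem_insert, Finset.mem_singleton]
    rcases e0 with e0 | e0 <;> rcases e1 with e1 | e1
    · exact .inl (hext _ (by simp [e0]) (by simp [e1]) (by simp) (by simp))
    · exact .inr (.inr (.inl (hext _ (by simp [e0, reflGL]) (by simp [e1, reflGL])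
        (by simp [reflGL]) (by simp [reflGL]))))
    · exact .inr (.inr (.inr (hext _ (by simp [e0, reflGL]) (by simp [e1, reflGL])
        (by simp [reflGL]) (by simp [reflGL]))))
    · exact .inr (.inl (hext _ (by simp [e0]) (by simp [e1]) (by simp) (by simp)))

theorem Reduced.smul {s : Bool} {f : BCF} (h : Reduced s f) {γ : GL (Fin 2) ℤ}
    (hγ : γ ∈ stabFD) : Reduced s (γ • f) := by
  obtain ⟨x, y, hy, hx, hN, hc⟩ := h
  obtain ⟨h01, h10⟩ := (mem_stabFD_iff γ).1 hγ
  have hd := real_det_sq γ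
  have hj := actJ_pos γ (x := x) hy
  have hc' := hc.smul γ hj.ne'
  rw [actN_eq γ hy] at hc'
  have hd2 := BCF.det_mul_det γ
  rw [h01, h10, zero_mul, sub_zero] at hd2
  have hu : γ 0 0 * (γ 1 1 * (γ 0 0 * γ 1 1)) = 1 := by linarith
  have hu' : γ 1 1 * (γ 0 0 * (γ 0 0 * γ 1 1)) = 1 := by linarith
  have e0 := Int.isUnit_iff.1 (IsUnit.of_mul_eq_one _ hu)
  have e1 := Int.isUnit_iff.1 (IsUnit.of_mul_eq_one _ hu')
  have hJ : actJ γ x (x ^ 2 + y ^ 2) = 1 := by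
    rcases e0 with e0 | e0 <;> simp [actJ, h01, e0]
  have hX : |actX γ x (x ^ 2 + y ^ 2)| = |x| := by
    rw [actX, hJ]
    rcases e0 with e0 | e0 <;> rcases e1 with e1 | e1 <;> simp [h01, h10, e0, e1]
  rw [hJ, div_one] at hc'
  refine ⟨_, y, hy, hX.le.trans hx, ?_, hc'⟩
  rw [← sq_abs, hX, sq_abs]
  exact hN

theorem one_lt_quadratic {x N : ℝ} (hx : |x| < 1 / 2) (hN : 1 < N) (c : ℤ) {d : ℤ} (hd : d ≠ 0) :
    1 < (c : ℝ) ^ 2 - 2 * x * c * d + N * (d : ℝ) ^ 2 := by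
  have hd1 : (1 : ℝ) ≤ (d : ℝ) ^ 2 := by
    have : 1 ≤ d ^ 2 := by have := sq_nonneg d; have : d ^ 2 ≠ 0 := by positivity
                           omega
    exact_mod_cast this
  have h1 : 2 * x * c * d ≤ |(c : ℝ)| * |(d : ℝ)| := by
    refine (le_abs_self _).trans ?_
    rw [abs_mul, abs_mul, abs_mul, abs_two]
    have := mul_nonneg (abs_nonneg (c : ℝ)) (abs_nonneg (d : ℝ))
    nlinarith
  have h2 : (1 : ℝ) ≤ (c : ℝ) ^ 2 - |(c : ℝ)| * |(d : ℝ)| + (d : ℝ) ^ 2 := by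
    have hge : 1 ≤ c ^ 2 - |c| * |d| + d ^ 2 := by
      have : 0 < |d| := abs_pos.2 hd
      rw [← sq_abs c, ← sq_abs d]
      nlinarith [sq_nonneg (|c| - |d|), abs_nonneg c, sq_nonneg (2 * |c| - |d|)]
    exact_mod_cast hge
  nlinarith

theorem StrictReduced.mem_stabFD {s : Bool} {f : BCF} (hd : f.disc ≠ 0) (h : StrictReduced s f)
    {γ : GL (Fin 2) ℤ} (h' : StrictReduced s (γ • f)) : γ ∈ stabFD := by
  obtain ⟨x, y, hy, hx, hN, hc⟩ := h
  obtain ⟨x', y', hy', hx', hN', hc'⟩ := h'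
  have hj := actJ_pos γ (x := x) hy
  have hcγ := hc.smul γ hj.ne'
  rw [actN_eq γ hy] at hcγ
  have hdγ : realDisc (γ • f).vec ≠ 0 := by
    rw [realDisc_vec, BCF.disc_smul]
    exact_mod_cast hd
  obtain ⟨hX, hY⟩ := hc'.unique hy' (div_pos hy hj) hdγ hcγ
  have hN'' : x' ^ 2 + y' ^ 2 = actN γ x (x ^ 2 + y ^ 2) := by
    rw [actN_eq γ hy, ← hX, ← hY]
  have hdet := real_det_sq γ
  have h01 : γ 0 1 = 0 := by
    by_contra h01
    have q1 := one_lt_quadratic hx hN (γ 0 0) h01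
    have q2 := one_lt_quadratic hx' hN' (-γ 1 1) h01
    rw [hN'', hX, actX, actN] at q2
    change 1 < actJ γ x (x ^ 2 + y ^ 2) at q1
    have key : ((-γ 1 1 : ℤ) : ℝ) ^ 2 - 2 * ((x * (γ 0 0 * γ 1 1 + γ 0 1 * γ 1 0)
        - (x ^ 2 + y ^ 2) * γ 0 1 * γ 1 1 - γ 0 0 * γ 1 0) / actJ γ x (x ^ 2 + y ^ 2))
        * ((-γ 1 1 : ℤ) : ℝ) * γ 0 1 + ((x ^ 2 + y ^ 2) * (γ 1 1 : ℝ) ^ 2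
        - 2 * x * γ 1 1 * γ 1 0 + (γ 1 0 : ℝ) ^ 2) / actJ γ x (x ^ 2 + y ^ 2) * (γ 0 1 : ℝ) ^ 2
        = 1 / actJ γ x (x ^ 2 + y ^ 2) := by
      push_cast
      field_simp
      rw [actJ]
      linear_combination hdet
    rw [key, lt_div_iff₀ hj] at q2
    linarith
  have hdz := BCF.det_mul_det γ
  rw [h01, zero_mul, sub_zero] at hdz
  have e0 := Int.isUnit_iff.1 (IsUnit.of_mul_eq_one (γ 1 1 * (γ 0 0 * γ 1 1))
    (by linarith : γ 0 0 * (γ 1 1 * (γ 0 0 * γ 1 1)) = 1))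
  have e1 := Int.isUnit_iff.1 (IsUnit.of_mul_eq_one (γ 0 0 * (γ 0 0 * γ 1 1))
    (by linarith : γ 1 1 * (γ 0 0 * (γ 0 0 * γ 1 1)) = 1))
  rw [mem_stabFD_iff]
  refine ⟨h01, ?_⟩
  have hJ : actJ γ x (x ^ 2 + y ^ 2) = 1 := by
    rcases e0 with e0 | e0 <;> simp [actJ, h01, e0]
  rw [actX, hJ, h01] at hX
  rw [abs_lt] at hx hx'
  have hb : |(γ 1 0 : ℝ)| < 1 := by
    rw [abs_lt]
    rcases e0 with e0 | e0 <;> rcases e1 with e1 | e1 <;> rw [e0, e1] at hX <;>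
      push_cast at hX <;> constructor <;> linarith
  have : |γ 1 0| < 1 := by exact_mod_cast hb
  exact Int.abs_lt_one_iff.1 this

/-- The Jacobian matrix of `cubicParam`. -/
def cubicJac (s : Bool) (w : Fin 4 → ℝ) : Matrix (Fin 4) (Fin 4) ℝ :=
  !![1, 0, 0, 0;
    -3 * w 2, cB s * w 3, -3 * w 0, cB s * w 1;
    3 * w 2 ^ 2 + cC s * w 3 ^ 2, -2 * w 2 * cB s * w 3,
      6 * w 2 * w 0 - 2 * cB s * w 1 * w 3, -2 * w 2 * cB s * w 1 + 2 * cC s * w 0 * w 3;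
    -w 2 ^ 3 - w 2 * cC s * w 3 ^ 2, w 2 ^ 2 * cB s * w 3 + cD s * w 3 ^ 3,
      -3 * w 2 ^ 2 * w 0 + 2 * w 2 * cB s * w 1 * w 3 - cC s * w 0 * w 3 ^ 2,
      w 2 ^ 2 * cB s * w 1 - 2 * w 2 * cC s * w 0 * w 3 + 3 * cD s * w 1 * w 3 ^ 2]

theorem abs_det_cubicJac (s : Bool) (w : Fin 4 → ℝ) :
    |(cubicJac s w).det| = cJ s * (w 3 ^ 4 * (w 0 ^ 2 + w 1 ^ 2)) := by
  have h : 0 ≤ cJ s * (w 3 ^ 4 * (w 0 ^ 2 + w 1 ^ 2)) := by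
    cases s <;> simp only [cJ] <;> positivity
  rw [← abs_of_nonneg h, abs_eq_abs]
  cases s
  · simp [cubicJac, Matrix.det_succ_row_zero, Fin.sum_univ_succ, Fin.succAbove, cB, cC, cD, cJ]
    right; ring1
  · simp [cubicJac, Matrix.det_succ_row_zero, Fin.sum_univ_succ, Fin.succAbove, cB, cC, cD, cJ]
    left; ring1

/-- The derivative of `cubicParam`. -/
noncomputable def cubicDeriv (s : Bool) (w : Fin 4 → ℝ) : (Fin 4 → ℝ) →L[ℝ] (Fin 4 → ℝ) :=
  LinearMap.toContinuousLinearMap (Matrix.toLin' (cubicJac s w))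

theorem det_cubicDeriv (s : Bool) (w : Fin 4 → ℝ) :
    |(cubicDeriv s w).det| = cJ s * (w 3 ^ 4 * (w 0 ^ 2 + w 1 ^ 2)) := by
  rw [← abs_det_cubicJac, cubicDeriv, ContinuousLinearMap.det]
  simp

theorem hasStrictFDerivAt_cubicParam (s : Bool) (w : Fin 4 → ℝ) :
    HasStrictFDerivAt (cubicParam s) (cubicDeriv s w) w := by
  have hp (j : Fin 4) : HasStrictFDerivAt (fun w : Fin 4 → ℝ => w j)
      (ContinuousLinearMap.proj (R := ℝ) j) w :=
    (ContinuousLinearMap.proj (R := ℝ) (φ := fun _ : Fin 4 => ℝ) j).hasStrictFDerivAt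
  rw [hasStrictFDerivAt_pi']
  intro i
  fin_cases i
  · refine (hp 0).congr_fderiv ?_
    ext v
    simp [cubicDeriv, cubicJac, vecHead, vecTail]
  · refine ((((hp 2).const_mul (-3)).mul (hp 0)).add
      (((hp 1).const_mul (cB s)).mul (hp 3))).congr_fderiv ?_
    ext v
    simp [cubicDeriv, cubicJac, vecHead, vecTail]
    ring
  · refine (((((hp 2).pow 2).const_mul 3).mul (hp 0)).sub
      (((((hp 2).const_mul 2).mul_const (cB s)).mul (hp 1)).mul (hp 3)) |>.add
      (((hp 0).const_mul (cC s)).mul ((hp 3).pow 2))).congr_fderiv ?_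
    ext v
    simp [cubicDeriv, cubicJac, vecHead, vecTail]
    ring
  · refine ((((((hp 2).pow 3).neg.mul (hp 0)).add
      (((((hp 2).pow 2).mul_const (cB s)).mul (hp 1)).mul (hp 3))).sub
      ((((hp 2).mul_const (cC s)).mul (hp 0)).mul ((hp 3).pow 2))).add
      (((hp 1).const_mul (cD s)).mul ((hp 3).pow 3))).congr_fderiv ?_
    ext v
    simp [cubicDeriv, cubicJac, vecHead, vecTail]
    ring

/-- Open truncated parameter domain: normalised discriminant, covariant point strictly inside
the fundamental domain, of height less than `Y`. -/
def paramDom (s : Bool) (Y : ℝ) : Set (Fin 4 → ℝ) :=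
  {w | 0 < w 0 ^ 2 + w 1 ^ 2 ∧ |cS s| * w 3 ^ 6 * (w 0 ^ 2 + w 1 ^ 2) ^ 2 < 1 ∧ |w 2| < 1 / 2 ∧
    1 < w 2 ^ 2 + w 3 ^ 2 ∧ 0 < w 3 ∧ w 3 < Y}

/-- Closed truncated parameter domain. -/
def paramCDom (s : Bool) (Y : ℝ) : Set (Fin 4 → ℝ) :=
  {w | |cS s| * w 3 ^ 6 * (w 0 ^ 2 + w 1 ^ 2) ^ 2 ≤ 1 ∧ |w 2| ≤ 1 / 2 ∧
    1 ≤ w 2 ^ 2 + w 3 ^ 2 ∧ 0 ≤ w 3 ∧ w 3 ≤ Y}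

theorem paramDom_subset (s : Bool) (Y : ℝ) : paramDom s Y ⊆ paramCDom s Y :=
  fun _ h => ⟨h.2.1.le, h.2.2.1.le, h.2.2.2.1.le, h.2.2.2.2.1.le, h.2.2.2.2.2.le⟩

theorem isOpen_paramDom (s : Bool) (Y : ℝ) : IsOpen (paramDom s Y) := by
  simp only [paramDom, Set.ofPred_and]
  refine IsOpen.inter ?_ (IsOpen.inter ?_ (IsOpen.inter ?_ (IsOpen.inter ?_ (IsOpen.inter ?_ ?_))))
  all_goals exact isOpen_lt (by fun_prop) (by fun_prop)

theorem isClosed_paramCDom (s : Bool) (Y : ℝ) : IsClosed (paramCDom s Y) := by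
  simp only [paramCDom, Set.ofPred_and]
  refine IsClosed.inter ?_ (IsClosed.inter ?_ (IsClosed.inter ?_ (IsClosed.inter ?_ ?_)))
  all_goals exact isClosed_le (by fun_prop) (by fun_prop)

theorem cS_ne_zero (s : Bool) : cS s ≠ 0 := by cases s <;> norm_num [cS]

theorem four_le_abs_cS (s : Bool) : 4 ≤ |cS s| := by
  cases s <;> norm_num [cS]

theorem isCompact_paramCDom (s : Bool) (Y : ℝ) : IsCompact (paramCDom s Y) := by
  refine Metric.isCompact_of_isClosed_isBounded (isClosed_paramCDom s Y) ?_
  refine (Metric.isBounded_closedBall (x := (0 : Fin 4 → ℝ)) (r := max 2 Y)).subset ?_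
  rintro w ⟨h1, h2, h3, h4, h5⟩
  rw [mem_closedBall_zero_iff, pi_norm_le_iff_of_nonneg (le_max_of_le_left two_pos.le)]
  have hx : w 2 ^ 2 ≤ 1 / 4 := by
    rw [← sq_abs]; nlinarith [abs_nonneg (w 2)]
  have hy : 3 / 4 ≤ w 3 ^ 2 := by linarith
  have hy6 : 27 / 64 ≤ w 3 ^ 6 := by
    calc (27 / 64 : ℝ) = (3 / 4) ^ 3 := by norm_num
      _ ≤ (w 3 ^ 2) ^ 3 := by gcongr
      _ = w 3 ^ 6 := by ring
  have hr : w 0 ^ 2 + w 1 ^ 2 ≤ 1 := by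
    by_contra! hc
    have h4S := four_le_abs_cS s
    have : 1 < (w 0 ^ 2 + w 1 ^ 2) ^ 2 := by nlinarith
    have h5 : 4 * (27 / 64) ≤ |cS s| * w 3 ^ 6 := by gcongr
    nlinarith
  have hsq (t : ℝ) (ht : t ^ 2 ≤ 1) : ‖t‖ ≤ max 2 Y := by
    refine le_max_of_le_left ?_
    rw [Real.norm_eq_abs]
    exact abs_le_of_sq_le_sq (by linarith) (by norm_num)
  intro i
  fin_cases i
  · exact hsq (w 0) (by nlinarith [sq_nonneg (w 1)])
  · exact hsq (w 1) (by nlinarith [sq_nonneg (w 0)])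
  · exact hsq (w 2) (by nlinarith)
  · refine le_max_of_le_right ?_
    simp only [Fin.reduceFinMk, Real.norm_eq_abs]
    rwa [abs_of_nonneg h4]

theorem injOn_cubicParam (s : Bool) (Y : ℝ) : Set.InjOn (cubicParam s) (paramDom s Y) := by
  intro w hw w' hw' h
  have hy : 0 < w 3 := hw.2.2.2.2.1
  have hy' : 0 < w' 3 := hw'.2.2.2.2.1
  have hd : realDisc (cubicParam s w) ≠ 0 := by
    rw [realDisc_cubicParam]
    exact mul_ne_zero (mul_ne_zero (cS_ne_zero s) (pow_pos hy 6).ne') (pow_pos hw.1 2).ne'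
  obtain ⟨h2, h3⟩ := (isCovariant_cubicParam s w).unique hy hy' hd
    (h ▸ isCovariant_cubicParam s w')
  have h0 : w 0 = w' 0 := by simpa [cubicParam] using congrFun h 0
  have h1 : w 1 = w' 1 := by
    have := congrFun h 1
    simp only [cubicParam, Matrix.cons_val_one, h2, h3, h0, Matrix.cons_val_zero] at this
    have h1' : (cB s * w' 3) * (w 1 - w' 1) = 0 := by linarith
    have := (mul_eq_zero.1 h1').resolve_left (mul_pos (cB_pos s) hy').ne'
    linarith
  ext i
  fin_cases i <;> assumption

theorem isOpen_image_paramDom (s : Bool) (Y : ℝ) : IsOpen (cubicParam s '' paramDom s Y) := by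
  rw [isOpen_iff_mem_nhds]
  rintro _ ⟨w, hw, rfl⟩
  have hdet : (cubicDeriv s w).det ≠ 0 := by
    rw [← abs_pos, det_cubicDeriv]
    have : 0 < cJ s := by cases s <;> norm_num [cJ]
    have := hw.2.2.2.2.1
    have := hw.1
    positivity
  have hsurj : (cubicDeriv s w).range = ⊤ := by
    exact LinearMap.range_eq_top.2
      ((LinearEquiv.ofIsUnitDet (f := (cubicDeriv s w : (Fin 4 → ℝ) →ₗ[ℝ] (Fin 4 → ℝ)))
        (v := Pi.basisFun ℝ (Fin 4)) (v' := Pi.basisFun ℝ (Fin 4)) (by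
          rw [LinearMap.det_toMatrix]; exact hdet.isUnit)).surjective)
  rw [← (hasStrictFDerivAt_cubicParam s w).map_nhds_eq_of_surj hsurj]
  exact image_mem_map ((isOpen_paramDom s Y).mem_nhds hw)

section MeasureTheory

open MeasureTheory

/-- A measurable set that is contained in the union of two graphs `w i = ± g` over the remaining
coordinates is null. -/
theorem volume_eq_zero_of_sections {n : ℕ} {S : Set (Fin (n + 1) → ℝ)} (hS : MeasurableSet S)
    (i : Fin (n + 1))
    (h : ∀ w ∈ S, ∀ w' ∈ S, (∀ j, j ≠ i → w j = w' j) → w' i = w i ∨ w' i = -w i) :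
    volume S = 0 := by
  have e := (volume_preserving_piFinSuccAbove (fun _ : Fin (n + 1) => ℝ) i).symm
  rw [← e.measure_preimage_equiv S]
  have hm := (MeasurableEquiv.piFinSuccAbove (fun _ : Fin (n + 1) => ℝ) i).symm.measurable hS
  rw [show (volume : Measure (ℝ × ((j : Fin n) → ℝ))) = (volume : Measure ℝ).prod volume from rfl,
    Measure.prod_apply_symm hm]
  refine lintegral_eq_zero_of_ae_eq_zero (.of_forall fun r => ?_)
  refine Set.Countable.measure_zero ?_ _
  set A := (fun t : ℝ => (t, r)) ⁻¹'
    ((MeasurableEquiv.piFinSuccAbove (fun _ : Fin (n + 1) => ℝ) i).symm ⁻¹' S) with hA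
  rcases A.eq_empty_or_nonempty with h0 | ⟨t, ht⟩
  · rw [h0]; exact Set.countable_empty
  · refine (Set.toFinite {t, -t}).countable.mono fun t' ht' => ?_
    have key (t : ℝ) (ht : t ∈ A) : i.insertNth (α := fun _ => ℝ) t r ∈ S := ht
    have := h _ (key t ht) _ (key t' ht') (fun j hj => by
      obtain ⟨k, rfl⟩ := Fin.exists_succAbove_eq hj
      simp)
    simpa using this

theorem volume_paramCDom_diff (s : Bool) (Y : ℝ) :
    volume (paramCDom s Y \ paramDom s Y) = 0 := by
  have hsub : paramCDom s Y \ paramDom s Y ⊆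
      {w | w 0 = 0} ∪ {w | 0 < w 3 ∧ |cS s| * w 3 ^ 6 * (w 0 ^ 2 + w 1 ^ 2) ^ 2 = 1} ∪
        {w | |w 2| = 1 / 2} ∪ {w | w 2 ^ 2 + w 3 ^ 2 = 1} ∪ {w | w 3 = Y} := by
    rintro w ⟨⟨h1, h2, h3, h4, h5⟩, hn⟩
    by_contra hc
    simp only [Set.mem_union, Set.mem_ofPred_eq, not_or] at hc
    obtain ⟨⟨⟨⟨c1, c2⟩, c3⟩, c4⟩, c5⟩ := hc
    have hy : 0 < w 3 := by
      refine lt_of_le_of_ne h4 fun h0 => ?_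
      rw [← h0] at h3
      rw [← sq_abs] at h3
      nlinarith [abs_nonneg (w 2)]
    exact hn ⟨by positivity, lt_of_le_of_ne h1 fun h => c2 ⟨hy, h⟩, lt_of_le_of_ne h2 c3,
      lt_of_le_of_ne h3 (Ne.symm c4), hy, lt_of_le_of_ne h5 c5⟩
  refine measure_mono_null hsub ?_
  simp only [measure_union_null_iff]
  refine ⟨⟨⟨⟨?_, ?_⟩, ?_⟩, ?_⟩, ?_⟩
  · refine volume_eq_zero_of_sections (measurableSet_eq_fun (by fun_prop) (by fun_prop)) 0 ?_
    rintro w hw w' hw' -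
    exact Or.inl (hw'.trans hw.symm)
  · rw [Set.ofPred_and]
    refine volume_eq_zero_of_sections
      ((measurableSet_lt (by fun_prop) (by fun_prop)).inter
        (measurableSet_eq_fun (by fun_prop) (by fun_prop))) 0 ?_
    rintro w ⟨hy, hw⟩ w' ⟨-, hw'⟩ h
    simp only [Set.mem_ofPred_eq] at hy hw hw'
    rw [← h 1 (by decide), ← h 3 (by decide), ← hw] at hw'
    have h4 := four_le_abs_cS s
    have h5 := mul_left_cancel₀ (by positivity) hw'
    have h6 := (pow_left_inj₀ (by positivity) (by positivity) two_ne_zero).1 h5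
    exact sq_eq_sq_iff_eq_or_eq_neg.1 (by linarith)
  · refine volume_eq_zero_of_sections (measurableSet_eq_fun (by fun_prop) (by fun_prop)) 2 ?_
    rintro w hw w' hw' -
    exact abs_eq_abs.1 (Eq.trans hw' (Eq.symm hw))
  · refine volume_eq_zero_of_sections (measurableSet_eq_fun (by fun_prop) (by fun_prop)) 3 ?_
    rintro w hw w' hw' h
    simp only [Set.mem_ofPred_eq] at hw hw'
    rw [← h 2 (by decide), ← hw] at hw'
    exact sq_eq_sq_iff_eq_or_eq_neg.1 (by linarith)
  · refine volume_eq_zero_of_sections (measurableSet_eq_fun (by fun_prop) (by fun_prop)) 3 ?_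
    rintro w hw w' hw' -
    exact Or.inl (Eq.trans hw' (Eq.symm hw))

theorem volume_image_paramCDom_diff (s : Bool) (Y : ℝ) :
    volume (cubicParam s '' paramCDom s Y \ cubicParam s '' paramDom s Y) = 0 := by
  have hsub : cubicParam s '' paramCDom s Y \ cubicParam s '' paramDom s Y ⊆
      cubicParam s '' (paramCDom s Y \ paramDom s Y) := by
    rintro _ ⟨⟨w, hw, rfl⟩, h⟩
    exact ⟨w, ⟨hw, fun h' => h ⟨w, h', rfl⟩⟩, rfl⟩
  refine measure_mono_null hsub ?_
  exact addHaar_image_eq_zero_of_differentiableOn_of_addHaar_eq_zero _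
    (fun w _ =>
      (hasStrictFDerivAt_cubicParam s w).hasFDerivAt.differentiableAt.differentiableWithinAt)
    (volume_paramCDom_diff s Y)

theorem isCompact_image_paramCDom (s : Bool) (Y : ℝ) :
    IsCompact (cubicParam s '' paramCDom s Y) :=
  (isCompact_paramCDom s Y).image (continuous_iff_continuousAt.2 fun w =>
    (hasStrictFDerivAt_cubicParam s w).continuousAt)

theorem volume_frontier_image_paramDom (s : Bool) (Y : ℝ) :
    volume (frontier (cubicParam s '' paramDom s Y)) = 0 := by
  refine measure_mono_null ?_ (volume_image_paramCDom_diff s Y)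
  rw [(isOpen_image_paramDom s Y).frontier_eq]
  exact Set.sdiff_subset_sdiff_left (closure_minimal (Set.image_mono (paramDom_subset s Y))
    (isCompact_image_paramCDom s Y).isClosed)

theorem volume_frontier_image_paramCDom (s : Bool) (Y : ℝ) :
    volume (frontier (cubicParam s '' paramCDom s Y)) = 0 := by
  refine measure_mono_null ?_ (volume_image_paramCDom_diff s Y)
  rw [(isCompact_image_paramCDom s Y).isClosed.frontier_eq]
  exact Set.sdiff_subset_sdiff_right (interior_maximal (Set.image_mono (paramDom_subset s Y))
    (isOpen_image_paramDom s Y))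

theorem volume_image_paramCDom (s : Bool) (Y : ℝ) :
    volume (cubicParam s '' paramCDom s Y) = volume (cubicParam s '' paramDom s Y) :=
  (measure_eq_measure_of_null_sdiff (Set.image_mono (paramDom_subset s Y))
    (volume_image_paramCDom_diff s Y)).symm

theorem volume_image_paramDom (s : Bool) (Y : ℝ) :
    volume (cubicParam s '' paramDom s Y) =
      ∫⁻ w in paramDom s Y, ENNReal.ofReal (cJ s * (w 3 ^ 4 * (w 0 ^ 2 + w 1 ^ 2))) := by
  have := lintegral_image_eq_lintegral_abs_det_fderiv_mul volume
    (isOpen_paramDom s Y).measurableSet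
    (fun w _ => (hasStrictFDerivAt_cubicParam s w).hasFDerivAt.hasFDerivWithinAt)
    (injOn_cubicParam s Y) (fun _ => 1)
  simpa [det_cubicDeriv] using this

theorem lintegral_insertNth {n : ℕ} (i : Fin (n + 1)) {f : (Fin (n + 1) → ℝ) → ENNReal}
    (hf : Measurable f) :
    ∫⁻ w, f w = ∫⁻ t : ℝ, ∫⁻ r : Fin n → ℝ, f (i.insertNth (α := fun _ => ℝ) t r) := by
  have e := (volume_preserving_piFinSuccAbove (fun _ : Fin (n + 1) => ℝ) i).symm
  rw [← e.lintegral_comp hf]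
  exact lintegral_prod _ (hf.comp (MeasurableEquiv.measurable _)).aemeasurable

theorem lintegral_Ioo_of_hasDerivAt {F f : ℝ → ℝ} {a b : ℝ} (hab : a ≤ b)
    (hF : ∀ x ∈ Set.Icc a b, HasDerivAt F (f x) x) (hf : ContinuousOn f (Set.Icc a b))
    (h0 : ∀ x ∈ Set.Icc a b, 0 ≤ f x) :
    ∫⁻ x in Set.Ioo a b, ENNReal.ofReal (f x) = ENNReal.ofReal (F b - F a) := by
  have hi : IntervalIntegrable f volume a b := by
    apply ContinuousOn.intervalIntegrable
    rwa [Set.uIcc_of_le hab]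
  rw [← intervalIntegral.integral_eq_sub_of_hasDerivAt (f := F) (fun x hx => hF x (by
      rwa [Set.uIcc_of_le hab] at hx)) hi, intervalIntegral.integral_of_le hab,
    setLIntegral_congr Ioo_ae_eq_Ioc]
  rw [ofReal_integral_eq_lintegral_ofReal
    ((intervalIntegrable_iff_integrableOn_Ioc_of_le hab).1 hi)]
  exact (ae_restrict_mem measurableSet_Ioc).mono fun x hx => h0 x ⟨hx.1.le, hx.2⟩

/-- The integral of `p² + q²` over the punctured disc `A (p² + q²)² < 1`. -/
theorem lintegral_disc {A : ℝ} (hA : 0 < A) :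
    ∫⁻ z : ℝ × ℝ, {z : ℝ × ℝ | 0 < z.1 ^ 2 + z.2 ^ 2 ∧ A * (z.1 ^ 2 + z.2 ^ 2) ^ 2 < 1}.indicator
      (fun z => ENNReal.ofReal (z.1 ^ 2 + z.2 ^ 2)) z = ENNReal.ofReal (Real.pi / (2 * A)) := by
  rw [← lintegral_comp_polarCoord_symm]
  set R : ℝ := √√(1 / A)
  have hR : R ^ 4 = 1 / A := by
    rw [show 4 = 2 * 2 from rfl, pow_mul, Real.sq_sqrt (Real.sqrt_nonneg _),
      Real.sq_sqrt (by positivity)]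
  have hR0 : 0 ≤ R := Real.sqrt_nonneg _
  have hsq (p : ℝ × ℝ) : (p.1 * Real.cos p.2) ^ 2 + (p.1 * Real.sin p.2) ^ 2 = p.1 ^ 2 := by
    linear_combination p.1 ^ 2 * Real.sin_sq_add_cos_sq p.2
  have hmem (r : ℝ) (hr : 0 < r) : A * (r ^ 2) ^ 2 < 1 ↔ r < R := by
    rw [← pow_lt_pow_iff_left₀ hr.le hR0 (n := 4) (by norm_num), hR, lt_div_iff₀ hA]
    ring_nf
  have h1 : ∫⁻ p in polarCoord.target, ENNReal.ofReal p.1 •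
      {z : ℝ × ℝ | 0 < z.1 ^ 2 + z.2 ^ 2 ∧ A * (z.1 ^ 2 + z.2 ^ 2) ^ 2 < 1}.indicator
      (fun z => ENNReal.ofReal (z.1 ^ 2 + z.2 ^ 2)) (polarCoord.symm p) =
      ∫⁻ p in polarCoord.target, (Set.Iio R).indicator (fun r => ENNReal.ofReal (r ^ 3)) p.1 := by
    refine setLIntegral_congr_fun (polarCoord.open_target.measurableSet) fun p hp => ?_
    have hp : 0 < p.1 := by
      simp only [polarCoord_target, Set.mem_prod] at hp
      exact hp.1
    have hp2 : 0 < p.1 ^ 2 := by positivity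
    simp only [polarCoord_symm_apply, Set.indicator, Set.mem_ofPred_eq, hsq, hmem p.1 hp, hp2,
      true_and, Set.mem_Iio]
    split_ifs with h
    · rw [smul_eq_mul, ← ENNReal.ofReal_mul hp.le]
      ring_nf
    · simp
  rw [h1, polarCoord_target, Measure.volume_eq_prod, ← Measure.prod_restrict, lintegral_prod]
  · simp only [lintegral_const, Measure.restrict_apply MeasurableSet.univ, Set.univ_inter,
      Real.volume_Ioo]
    rw [lintegral_mul_const' _ _ ENNReal.ofReal_ne_top,
      setLIntegral_indicator measurableSet_Iio, Set.inter_comm, Set.Ioi_inter_Iio,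
      lintegral_Ioo_of_hasDerivAt (F := fun r => r ^ 4 / 4) hR0 (fun x _ => by
        simpa using (hasDerivAt_pow 4 x).div_const 4) (by fun_prop) (fun x hx => pow_nonneg hx.1 3),
      ← ENNReal.ofReal_mul (by rw [zero_pow four_ne_zero, zero_div, sub_zero]; positivity), hR]
    congr 1
    field_simp
    ring
  · refine Measurable.aemeasurable ?_
    refine Measurable.comp (g := (Set.Iio R).indicator (fun r => ENNReal.ofReal (r ^ 3))) ?_
      measurable_fst
    exact Measurable.indicator (by fun_prop) measurableSet_Iio

/-- Leading constant of the volume of the image of `paramDom`. -/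
noncomputable def volConst (s : Bool) : ℝ := cJ s * Real.pi / (2 * |cS s|)

theorem volConst_nonneg (s : Bool) : 0 ≤ volConst s := by
  cases s <;> simp only [volConst, cJ] <;> positivity

theorem volume_image_paramDom_eq (s : Bool) {Y : ℝ} (hY : 1 ≤ Y) :
    volume (cubicParam s '' paramDom s Y) =
      ENNReal.ofReal (volConst s * (Real.pi / 3 - 1 / Y)) := by
  have hY0 : 0 < Y := by linarith
  have hcJ : 0 ≤ cJ s := by cases s <;> norm_num [cJ]
  have hcS : 0 < |cS s| := abs_pos.2 (cS_ne_zero s)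
  rw [volume_image_paramDom, ← lintegral_indicator (isOpen_paramDom s Y).measurableSet]
  have hmeas : Measurable ((paramDom s Y).indicator fun w : Fin 4 → ℝ =>
      ENNReal.ofReal (cJ s * (w 3 ^ 4 * (w 0 ^ 2 + w 1 ^ 2)))) :=
    Measurable.indicator (by fun_prop) (isOpen_paramDom s Y).measurableSet
  rw [lintegral_insertNth (2 : Fin 4) hmeas]
  have hxint (x : ℝ) : ∫⁻ r : Fin 3 → ℝ, (paramDom s Y).indicator (fun w : Fin 4 → ℝ =>
      ENNReal.ofReal (cJ s * (w 3 ^ 4 * (w 0 ^ 2 + w 1 ^ 2))))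
        ((2 : Fin 4).insertNth (α := fun _ => ℝ) x r) =
      (Set.Ioo (-(1 / 2)) (1 / 2)).indicator (fun x =>
        ENNReal.ofReal (volConst s * (1 / √(1 - x ^ 2) - 1 / Y))) x := by
    by_cases hx : |x| < 1 / 2
    swap
    · rw [Set.indicator_of_notMem (by rwa [Set.mem_Ioo, ← abs_lt])]
      refine lintegral_eq_zero_of_ae_eq_zero (.of_forall fun r => ?_)
      exact Set.indicator_of_notMem (fun h => hx h.2.2.1) _
    rw [Set.indicator_of_mem (by rwa [Set.mem_Ioo, ← abs_lt])]
    have hx2 : x ^ 2 < 1 / 4 := by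
      rw [← sq_abs]; nlinarith [abs_nonneg x]
    have hins : Measurable fun r : Fin 3 → ℝ => (2 : Fin 4).insertNth (α := fun _ => ℝ) x r := by
      refine measurable_pi_iff.2 fun i => ?_
      fin_cases i
      · exact measurable_pi_apply (0 : Fin 3)
      · exact measurable_pi_apply (1 : Fin 3)
      · exact measurable_const
      · exact measurable_pi_apply (2 : Fin 3)
    refine (lintegral_insertNth (2 : Fin 3) (hmeas.comp hins)).trans ?_
    simp only [Function.comp_apply]
    have hyint (y : ℝ) : ∫⁻ r : Fin 2 → ℝ, (paramDom s Y).indicator (fun w : Fin 4 → ℝ =>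
      ENNReal.ofReal (cJ s * (w 3 ^ 4 * (w 0 ^ 2 + w 1 ^ 2))))
        ((2 : Fin 4).insertNth (α := fun _ => ℝ) x
          ((2 : Fin 3).insertNth (α := fun _ => ℝ) y r)) =
        (Set.Ioo (√(1 - x ^ 2)) Y).indicator
          (fun y => ENNReal.ofReal (volConst s * (1 / y ^ 2))) y := by
      by_cases hy : y ∈ Set.Ioo (√(1 - x ^ 2)) Y
      swap
      · rw [Set.indicator_of_notMem hy]
        refine lintegral_eq_zero_of_ae_eq_zero (.of_forall fun r => ?_)
        refine Set.indicator_of_notMem (fun h => hy ⟨?_, h.2.2.2.2.2⟩) _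
        have h0 : 0 < y := h.2.2.2.2.1
        have : 1 < x ^ 2 + y ^ 2 := h.2.2.2.1
        exact (Real.sqrt_lt' h0).2 (by linarith)
      rw [Set.indicator_of_mem hy]
      have hy0 : 0 < y := (Real.sqrt_nonneg _).trans_lt hy.1
      have hy1 : 1 < x ^ 2 + y ^ 2 := by
        have := (Real.sqrt_lt' hy0).1 hy.1
        linarith
      have hA : 0 < |cS s| * y ^ 6 := by positivity
      have key (r : Fin 2 → ℝ) : (paramDom s Y).indicator (fun w : Fin 4 → ℝ =>
          ENNReal.ofReal (cJ s * (w 3 ^ 4 * (w 0 ^ 2 + w 1 ^ 2))))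
          ((2 : Fin 4).insertNth (α := fun _ => ℝ) x
            ((2 : Fin 3).insertNth (α := fun _ => ℝ) y r)) =
          ENNReal.ofReal (cJ s * y ^ 4) * {z : ℝ × ℝ | 0 < z.1 ^ 2 + z.2 ^ 2 ∧
            |cS s| * y ^ 6 * (z.1 ^ 2 + z.2 ^ 2) ^ 2 < 1}.indicator
            (fun z => ENNReal.ofReal (z.1 ^ 2 + z.2 ^ 2)) (r 0, r 1) := by
        simp only [Set.indicator]
        have hiff : (2 : Fin 4).insertNth (α := fun _ => ℝ) x
            ((2 : Fin 3).insertNth (α := fun _ => ℝ) y r) ∈ paramDom s Y ↔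
            (r 0, r 1) ∈ {z : ℝ × ℝ | 0 < z.1 ^ 2 + z.2 ^ 2 ∧
            |cS s| * y ^ 6 * (z.1 ^ 2 + z.2 ^ 2) ^ 2 < 1} :=
          ⟨fun h => ⟨h.1, h.2.1⟩, fun h => ⟨h.1, h.2, hx, hy1, hy0, hy.2⟩⟩
        simp only [hiff]
        split_ifs
        · rw [← ENNReal.ofReal_mul (by positivity)]
          congr 1
          rw [mul_assoc]
          rfl
        · simp
      simp only [key]
      rw [lintegral_const_mul' _ _ ENNReal.ofReal_ne_top]
      have hdisc := ((volume_preserving_finTwoArrow ℝ).lintegral_comp_emb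
        (MeasurableEquiv.finTwoArrow).measurableEmbedding _).trans (lintegral_disc hA)
      refine (congrArg _ hdisc).trans ?_
      rw [← ENNReal.ofReal_mul (by positivity), volConst]
      congr 1
      field_simp
    simp only [hyint]
    have hs0 : 0 < √(1 - x ^ 2) := Real.sqrt_pos.2 (by linarith)
    rw [lintegral_indicator measurableSet_Ioo,
      lintegral_Ioo_of_hasDerivAt (F := fun y => - (volConst s / y))
        ((Real.sqrt_le_one.2 (by nlinarith)).trans hY) _ _ _]
    · congr 1; ring
    · intro y hy
      have hy0 : y ≠ 0 := (hs0.trans_le hy.1).ne'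
      refine (((hasDerivAt_inv hy0).const_mul (-volConst s)).congr_deriv ?_).congr_of_eventuallyEq
        (.of_forall fun t => ?_)
      · ring
      · simp only [div_eq_mul_inv, neg_mul]
    · refine ContinuousOn.mul continuousOn_const (ContinuousOn.div continuousOn_const
        (by fun_prop) fun y hy => ?_)
      exact pow_ne_zero _ (hs0.trans_le hy.1).ne'
    · intro y _
      have := volConst_nonneg s
      positivity
  simp only [hxint]
  have hpos (x : ℝ) (hx : x ∈ Set.Icc (-(1 / 2) : ℝ) (1 / 2)) : 0 < 1 - x ^ 2 := by
    nlinarith [hx.1, hx.2]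
  rw [lintegral_indicator measurableSet_Ioo,
    lintegral_Ioo_of_hasDerivAt (F := fun x => volConst s * (Real.arcsin x - x / Y))
      (by norm_num) _ _ _]
  · congr 1
    have : Real.arcsin (1 / 2) = Real.pi / 6 :=
      Real.arcsin_eq_of_sin_eq Real.sin_pi_div_six
        ⟨by linarith [Real.pi_pos], by linarith [Real.pi_pos]⟩
    rw [Real.arcsin_neg, this]
    ring
  · intro x hx
    refine ((Real.hasDerivAt_arcsin ?_ ?_).sub ((hasDerivAt_id x).div_const Y)).const_mul _
    · linarith [hx.1]
    · linarith [hx.2]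
  · refine continuousOn_const.mul (ContinuousOn.sub (ContinuousOn.div continuousOn_const
      (by fun_prop) fun x hx => (Real.sqrt_pos.2 (hpos x hx)).ne') continuousOn_const)
  · intro x hx
    refine mul_nonneg (volConst_nonneg s) (sub_nonneg.2 ?_)
    refine one_div_le_one_div_of_le (Real.sqrt_pos.2 (hpos x hx)) (le_trans ?_ hY)
    exact Real.sqrt_le_one.2 (by nlinarith)

open Pointwise

theorem BCF.vec_injective : Function.Injective BCF.vec := by
  rintro ⟨a, b, c, d⟩ ⟨a', b', c', d'⟩ h
  have h0 := congrFun h 0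
  have h1 := congrFun h 1
  have h2 := congrFun h 2
  have h3 := congrFun h 3
  simp only [BCF.vec, Matrix.cons_val_zero, Matrix.cons_val_one, Matrix.cons_val, Int.cast_inj]
    at h0 h1 h2 h3
  rw [h0, h1, h2, h3]

theorem BCF.finite_of_abs_le {S : Set BCF} {N : ℤ}
    (h : ∀ f ∈ S, |f.a| ≤ N ∧ |f.b| ≤ N ∧ |f.c| ≤ N ∧ |f.d| ≤ N) : S.Finite := by
  refine Set.Finite.of_finite_image (f := fun f : BCF => (f.a, f.b, f.c, f.d))
    ((((Set.finite_Icc (-N) N).prod ((Set.finite_Icc (-N) N).prod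
      ((Set.finite_Icc (-N) N).prod (Set.finite_Icc (-N) N))))).subset ?_) ?_
  · rintro _ ⟨f, hf, rfl⟩
    obtain ⟨h1, h2, h3, h4⟩ := h f hf
    exact ⟨abs_le.1 h1, abs_le.1 h2, abs_le.1 h3, abs_le.1 h4⟩
  · rintro ⟨a, b, c, d⟩ _ ⟨a', b', c', d'⟩ _ h
    simpa using h

/-- Integral forms in the dilate `T • V`. -/
def formsIn (V : Set (Fin 4 → ℝ)) (T : ℝ) : Set BCF := {f | T⁻¹ • f.vec ∈ V}

theorem BCF.abs_le_norm_vec (f : BCF) :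
    |(f.a : ℝ)| ≤ ‖f.vec‖ ∧ |(f.b : ℝ)| ≤ ‖f.vec‖ ∧ |(f.c : ℝ)| ≤ ‖f.vec‖ ∧ |(f.d : ℝ)| ≤ ‖f.vec‖ :=
  ⟨norm_le_pi_norm f.vec 0, norm_le_pi_norm f.vec 1, norm_le_pi_norm f.vec 2,
    norm_le_pi_norm f.vec 3⟩

theorem norm_vec_le_of_mem_formsIn {V : Set (Fin 4 → ℝ)} {R T : ℝ} (hT : 0 < T)
    (hV : V ⊆ Metric.closedBall 0 R) {f : BCF} (hf : f ∈ formsIn V T) : ‖f.vec‖ ≤ R * T := by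
  have := mem_closedBall_zero_iff.1 (hV hf)
  rw [norm_smul, Real.norm_eq_abs, abs_inv, abs_of_pos hT, inv_mul_le_iff₀ hT] at this
  linarith

theorem BCF.finite_of_norm_vec_le {S : Set BCF} {R : ℝ} (h : ∀ f ∈ S, ‖f.vec‖ ≤ R) : S.Finite := by
  refine BCF.finite_of_abs_le (N := ⌈R⌉) fun f hf => ?_
  obtain ⟨h1, h2, h3, h4⟩ := f.abs_le_norm_vec
  have h0 := (h f hf).trans (Int.le_ceil R)
  refine ⟨?_, ?_, ?_, ?_⟩
  · exact_mod_cast h1.trans h0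
  · exact_mod_cast h2.trans h0
  · exact_mod_cast h3.trans h0
  · exact_mod_cast h4.trans h0

theorem finite_formsIn {V : Set (Fin 4 → ℝ)} {T : ℝ} (hT : 0 < T) (hV : Bornology.IsBounded V) :
    (formsIn V T).Finite := by
  obtain ⟨R, hR⟩ := hV.subset_closedBall 0
  exact BCF.finite_of_norm_vec_le fun f hf => norm_vec_le_of_mem_formsIn hT hR hf

theorem range_vec : Set.range BCF.vec =
    (Submodule.span ℤ (Set.range (Pi.basisFun ℝ (Fin 4))) : Set (Fin 4 → ℝ)) := by
  ext v
  simp only [Set.mem_range, SetLike.mem_coe, Module.Basis.mem_span_iff_repr_mem, Pi.basisFun_repr,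
    algebraMap_int_eq, Int.coe_castRingHom]
  constructor
  · rintro ⟨f, rfl⟩ i
    fin_cases i
    exacts [⟨f.a, rfl⟩, ⟨f.b, rfl⟩, ⟨f.c, rfl⟩, ⟨f.d, rfl⟩]
  · intro h
    choose g hg using h
    refine ⟨⟨g 0, g 1, g 2, g 3⟩, ?_⟩
    ext i
    fin_cases i
    exacts [hg 0, hg 1, hg 2, hg 3]

theorem tendsto_card_formsIn {V : Set (Fin 4 → ℝ)} (h1 : Bornology.IsBounded V)
    (h2 : MeasurableSet V) (h3 : volume (frontier V) = 0)
    (h4 : ∀ v ∈ V, ∀ t : ℝ, 0 < t → t ≤ 1 → t • v ∈ V) :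
    Tendsto (fun T : ℝ => ((formsIn V T).ncard : ℝ) / T ^ 4) atTop (𝓝 (volume.real V)) := by
  refine (tendsto_card_div_pow_atTop_volume' V h1 h2 h3 ?_).congr' ?_
  · rintro x y hx hxy _ ⟨v, hv, rfl⟩
    have hy : 0 < y := hx.trans_le hxy
    refine ⟨(x / y) • v, h4 v hv _ (div_pos hx hy) ((div_le_one hy).2 hxy), ?_⟩
    simp only [smul_smul]
    congr 1
    field_simp
  · filter_upwards [eventually_gt_atTop 0] with T hT
    rw [Fintype.card_fin]
    congr 2
    rw [← range_vec, Nat.card_coe_set_eq]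
    have : V ∩ T⁻¹ • Set.range BCF.vec = (fun f : BCF => T⁻¹ • f.vec) '' formsIn V T := by
      ext v
      constructor
      · rintro ⟨hv, _, ⟨f, rfl⟩, rfl⟩
        exact ⟨f, hv, rfl⟩
      · rintro ⟨f, hf, rfl⟩
        exact ⟨hf, _, ⟨f, rfl⟩, rfl⟩
    rw [this]
    refine Set.ncard_image_of_injective _ fun f g h => BCF.vec_injective ?_
    exact smul_right_injective _ (inv_ne_zero hT.ne') h

theorem smul_cubicParam (s : Bool) (t : ℝ) (w : Fin 4 → ℝ) :
    t • cubicParam s w = cubicParam s ![t * w 0, t * w 1, w 2, w 3] := by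
  ext i
  fin_cases i <;> simp [cubicParam] <;> ring

theorem volume_real_image_paramDom (s : Bool) {Y : ℝ} (hY : 1 ≤ Y) :
    volume.real (cubicParam s '' paramDom s Y) = volConst s * (Real.pi / 3 - 1 / Y) := by
  rw [measureReal_def, volume_image_paramDom_eq s hY, ENNReal.toReal_ofReal]
  refine mul_nonneg (volConst_nonneg s) (sub_nonneg.2 ?_)
  have : 1 / Y ≤ 1 := (div_le_one (by linarith)).2 hY
  linarith [Real.pi_gt_three]

theorem isBounded_image_paramDom (s : Bool) (Y : ℝ) :
    Bornology.IsBounded (cubicParam s '' paramDom s Y) :=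
  (isCompact_image_paramCDom s Y).isBounded.subset (Set.image_mono (paramDom_subset s Y))

theorem tendsto_card_paramDom (s : Bool) {Y : ℝ} (hY : 1 ≤ Y) :
    Tendsto (fun T : ℝ => ((formsIn (cubicParam s '' paramDom s Y) T).ncard : ℝ) / T ^ 4) atTop
      (𝓝 (volConst s * (Real.pi / 3 - 1 / Y))) := by
  rw [← volume_real_image_paramDom s hY]
  refine tendsto_card_formsIn (isBounded_image_paramDom s Y)
    (isOpen_image_paramDom s Y).measurableSet (volume_frontier_image_paramDom s Y) ?_
  rintro _ ⟨w, ⟨h1, h2, h3⟩, rfl⟩ t ht ht1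
  refine ⟨![t * w 0, t * w 1, w 2, w 3], ⟨?_, ?_, h3⟩, (smul_cubicParam s t w).symm⟩
  · simp only [Matrix.cons_val_zero, Matrix.cons_val_one]
    rw [mul_pow, mul_pow, ← mul_add]
    positivity
  · simp only [Matrix.cons_val_zero, Matrix.cons_val_one, Matrix.cons_val]
    refine lt_of_le_of_lt ?_ h2
    rw [mul_pow, mul_pow, ← mul_add]
    have : t ^ 2 ≤ 1 := pow_le_one₀ ht.le ht1
    gcongr
    exact mul_le_of_le_one_left (by positivity) this

theorem tendsto_card_paramCDom (s : Bool) {Y : ℝ} (hY : 1 ≤ Y) :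
    Tendsto (fun T : ℝ => ((formsIn (cubicParam s '' paramCDom s Y) T).ncard : ℝ) / T ^ 4) atTop
      (𝓝 (volConst s * (Real.pi / 3 - 1 / Y))) := by
  rw [← volume_real_image_paramDom s hY, measureReal_def, ← volume_image_paramCDom,
    ← measureReal_def]
  refine tendsto_card_formsIn (isCompact_image_paramCDom s Y).isBounded
    (isCompact_image_paramCDom s Y).measurableSet (volume_frontier_image_paramCDom s Y) ?_
  rintro _ ⟨w, ⟨h2, h3⟩, rfl⟩ t ht ht1
  refine ⟨![t * w 0, t * w 1, w 2, w 3], ⟨?_, h3⟩, (smul_cubicParam s t w).symm⟩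
  simp only [Matrix.cons_val_zero, Matrix.cons_val_one, Matrix.cons_val]
  refine le_trans ?_ h2
  rw [mul_pow, mul_pow, ← mul_add]
  have : t ^ 2 ≤ 1 := pow_le_one₀ ht.le ht1
  gcongr
  exact mul_le_of_le_one_left (by positivity) this

theorem realDisc_smul (t : ℝ) (v : Fin 4 → ℝ) : realDisc (t • v) = t ^ 4 * realDisc v := by
  simp only [realDisc, Pi.smul_apply, smul_eq_mul]; ring

theorem IsCovariant.smul_vec {s : Bool} {v : Fin 4 → ℝ} {x N : ℝ} (h : IsCovariant s v x N)
    (t : ℝ) : IsCovariant s (t • v) x N := by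
  cases s <;> simp only [IsCovariant, Pi.smul_apply, smul_eq_mul] at h ⊢ <;> constructor
  · linear_combination t * h.1
  · linear_combination t * h.2
  · linear_combination t * h.1
  · linear_combination t * h.2

theorem abs_realDisc_cubicParam (s : Bool) (w : Fin 4 → ℝ) :
    |realDisc (cubicParam s w)| = |cS s| * w 3 ^ 6 * (w 0 ^ 2 + w 1 ^ 2) ^ 2 := by
  rw [realDisc_cubicParam, abs_mul, abs_mul,
    abs_of_nonneg (show 0 ≤ w 3 ^ 6 by rw [show 6 = 3 * 2 from rfl, pow_mul]; positivity),
    abs_of_nonneg (show 0 ≤ (w 0 ^ 2 + w 1 ^ 2) ^ 2 by positivity)]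

theorem cS_mul_pos_of_mem {s : Bool} {Y T : ℝ} (hT : 0 < T) {f : BCF}
    (hf : f ∈ formsIn (cubicParam s '' paramDom s Y) T) :
    StrictReduced s f ∧ 0 < cS s * (f.disc : ℝ) ∧ |(f.disc : ℝ)| < T ^ 4 := by
  obtain ⟨w, ⟨h1, h2, h3, h4, h5, -⟩, hw⟩ := hf
  have hvec : f.vec = T • cubicParam s w := by
    rw [hw, smul_smul, mul_inv_cancel₀ hT.ne', one_smul]
  have hdisc : (f.disc : ℝ) = T ^ 4 * (cS s * w 3 ^ 6 * (w 0 ^ 2 + w 1 ^ 2) ^ 2) := by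
    rw [← realDisc_vec, hvec, realDisc_smul, realDisc_cubicParam]
  refine ⟨⟨w 2, w 3, h5, h3, h4, ?_⟩, ?_, ?_⟩
  · rw [hvec]
    exact (isCovariant_cubicParam s w).smul_vec T
  · have := cS_ne_zero s
    rw [hdisc, show cS s * (T ^ 4 * (cS s * w 3 ^ 6 * (w 0 ^ 2 + w 1 ^ 2) ^ 2)) =
      cS s ^ 2 * (T ^ 4 * (w 3 ^ 6 * (w 0 ^ 2 + w 1 ^ 2) ^ 2)) by ring]
    positivity
  · rw [← realDisc_vec, hvec, realDisc_smul, abs_mul, abs_realDisc_cubicParam,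
      abs_of_pos (show 0 < T ^ 4 by positivity)]
    exact mul_lt_of_lt_one_right (by positivity) h2

theorem mem_formsIn_paramCDom {s : Bool} {Y T x y : ℝ} (hT : 0 < T) {f : BCF} (hy : 0 < y)
    (hx : |x| ≤ 1 / 2) (hN : 1 ≤ x ^ 2 + y ^ 2) (h : IsCovariant s f.vec x (x ^ 2 + y ^ 2))
    (hd : |(f.disc : ℝ)| ≤ T ^ 4) (hY : y ≤ Y) :
    f ∈ formsIn (cubicParam s '' paramCDom s Y) T := by
  have h' := (h.smul_vec T⁻¹).eq_cubicParam hy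
  refine ⟨_, ⟨?_, hx, hN, hy.le, hY⟩, h'.symm⟩
  rw [← abs_realDisc_cubicParam, ← h', realDisc_smul, realDisc_vec, abs_mul,
    abs_of_pos (show 0 < T⁻¹ ^ 4 by positivity), inv_pow, inv_mul_le_iff₀ (by positivity)]
  linarith

end MeasureTheory

theorem Int.natCast_card_Icc_floor_le (A : ℝ) (hA : 0 ≤ A) :
    ((Finset.Icc (-⌊A⌋) ⌊A⌋).card : ℝ) ≤ 2 * A + 1 := by
  have h0 : 0 ≤ ⌊A⌋ := Int.floor_nonneg.2 hA
  have h : (((Finset.Icc (-⌊A⌋) ⌊A⌋).card : ℤ) : ℝ) = 2 * (⌊A⌋ : ℝ) + 1 := by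
    rw [Int.card_Icc, Int.toNat_of_nonneg (by linarith)]
    push_cast; ring
  have := Int.floor_le A
  rw [Int.cast_natCast] at h
  linarith

theorem Int.natCast_card_Icc_floor_erase_le (A : ℝ) (hA : 0 ≤ A) :
    (((Finset.Icc (-⌊A⌋) ⌊A⌋).erase 0).card : ℝ) ≤ 2 * A := by
  have h0 : 0 ≤ ⌊A⌋ := Int.floor_nonneg.2 hA
  have h := Finset.card_erase_add_one (s := Finset.Icc (-⌊A⌋) ⌊A⌋) (a := 0) (by simp [h0])
  have h1 := Int.natCast_card_Icc_floor_le A hA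
  rw [← h] at h1
  push_cast at h1
  linarith

theorem Int.mem_Icc_floor_of_abs_le {A : ℝ} {n : ℤ} (h : |(n : ℝ)| ≤ A) :
    n ∈ Finset.Icc (-⌊A⌋) ⌊A⌋ := by
  rw [Finset.mem_Icc, ← abs_le, Int.le_floor]
  exact_mod_cast h

theorem Int.natCast_card_Icc_le (u l : ℝ) (hl : 0 ≤ l) :
    ((Finset.Icc ⌈u⌉ ⌊u + l⌋).card : ℝ) ≤ l + 1 := by
  rw [Int.card_Icc]
  have h1 := Int.floor_le (u + l)
  have h2 := Int.le_ceil u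
  have h3 : ((((⌊u + l⌋ + 1 - ⌈u⌉).toNat : ℤ)) : ℝ) ≤ l + 1 := by
    rw [Int.toNat_eq_max]
    push_cast
    exact max_le (by linarith) (by linarith)
  exact_mod_cast h3

/-- Counting forms whose last coefficient is confined to a short interval depending on the
others. -/
theorem BCF.card_le_of_interval {S : Finset BCF} {A B C l : ℝ} (hA : 0 ≤ A) (hB : 0 ≤ B)
    (hC : 0 ≤ C) (hl : 0 ≤ l)
    (h : ∀ f ∈ S, f.a ≠ 0 ∧ |(f.a : ℝ)| ≤ A ∧ |(f.b : ℝ)| ≤ B ∧ |(f.c : ℝ)| ≤ C)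
    (hd : ∀ a b c : ℤ, ∃ u : ℝ, ∀ f ∈ S, f.a = a → f.b = b → f.c = c →
      u ≤ f.d ∧ (f.d : ℝ) ≤ u + l) :
    (S.card : ℝ) ≤ (l + 1) * (2 * A * ((2 * B + 1) * (2 * C + 1))) := by
  have h1 : S.card ≤ ⌊l + 1⌋₊ * (S.image fun f => (f.a, f.b, f.c)).card := by
    refine Finset.card_le_mul_card_image _ _ ?_
    rintro ⟨a, b, c⟩ -
    obtain ⟨u, hu⟩ := hd a b c
    refine Nat.le_floor (le_trans ?_ (Int.natCast_card_Icc_le u l hl))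
    refine Nat.cast_le.2 (Finset.card_le_card_of_injOn (fun f => f.d) ?_ ?_)
    · intro f hf
      simp only [Finset.coe_filter, Set.mem_ofPred_eq, Prod.mk.injEq] at hf
      obtain ⟨h1, h2⟩ := hu f hf.1 hf.2.1 hf.2.2.1 hf.2.2.2
      simpa [Int.ceil_le, Int.le_floor] using ⟨h1, h2⟩
    · rintro ⟨a', b', c', d'⟩ hf ⟨a'', b'', c'', d''⟩ hg hfg
      simp only [Finset.coe_filter, Set.mem_ofPred_eq, Prod.mk.injEq] at hf hg hfg
      rw [BCF.mk.injEq]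
      exact ⟨hf.2.1.trans hg.2.1.symm, hf.2.2.1.trans hg.2.2.1.symm,
        hf.2.2.2.trans hg.2.2.2.symm, hfg⟩
  have h2 : (S.image fun f => (f.a, f.b, f.c)).card ≤
      (((Finset.Icc (-⌊A⌋) ⌊A⌋).erase 0) ×ˢ ((Finset.Icc (-⌊B⌋) ⌊B⌋) ×ˢ
        (Finset.Icc (-⌊C⌋) ⌊C⌋))).card := by
    refine Finset.card_le_card fun t ht => ?_
    obtain ⟨f, hf, rfl⟩ := Finset.mem_image.1 ht
    obtain ⟨h0, h1, h2, h3⟩ := h f hf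
    simp only [Finset.mem_product, Finset.mem_erase]
    exact ⟨⟨h0, Int.mem_Icc_floor_of_abs_le h1⟩, Int.mem_Icc_floor_of_abs_le h2,
      Int.mem_Icc_floor_of_abs_le h3⟩
  rw [Finset.card_product, Finset.card_product] at h2
  have h3 : (S.card : ℝ) ≤ (⌊l + 1⌋₊ : ℝ) * (((Finset.Icc (-⌊A⌋) ⌊A⌋).erase 0).card *
      ((Finset.Icc (-⌊B⌋) ⌊B⌋).card * (Finset.Icc (-⌊C⌋) ⌊C⌋).card) : ℝ) := by
    exact_mod_cast h1.trans (Nat.mul_le_mul_left _ h2)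
  refine h3.trans ?_
  gcongr
  · exact Nat.floor_le (by linarith)
  · exact Int.natCast_card_Icc_floor_erase_le A hA
  · exact Int.natCast_card_Icc_floor_le B hB
  · exact Int.natCast_card_Icc_floor_le C hC

/-- The ratio for which `a d - η b c` is small on forms high in the cusp. -/
noncomputable def cEta : Bool → ℝ
  | true => 1 / 9
  | false => 1

/-- Integral forms satisfying the size constraints of reduced forms of height about `σ²`. -/
def cuspBlock (s : Bool) (σ T : ℝ) : Set BCF :=
  {f | f.a ≠ 0 ∧ |(f.a : ℝ)| * σ ^ 3 ≤ T ∧ |(f.b : ℝ)| * σ ≤ 14 * T ∧ |(f.c : ℝ)| ≤ 61 * T * σ ∧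
    |(f.d : ℝ)| ≤ 92 * T * σ ^ 3 ∧ |(f.a * f.d - cEta s * f.b * f.c : ℝ)| * σ ^ 2 ≤ 80 * T ^ 2}

theorem finite_cuspBlock (s : Bool) {σ T : ℝ} (hσ : 1 ≤ σ) (hT : 0 ≤ T) :
    (cuspBlock s σ T).Finite := by
  refine BCF.finite_of_norm_vec_le (R := 92 * T * σ ^ 3) ?_
  rintro f ⟨-, h1, h2, h3, h4, -⟩
  rw [pi_norm_le_iff_of_nonneg (by positivity)]
  have hσ3 : 1 ≤ σ ^ 3 := one_le_pow₀ hσ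
  have hT3 : T ≤ T * σ ^ 3 := le_mul_of_one_le_right hT hσ3
  intro i
  fin_cases i
  · exact (le_mul_of_one_le_right (abs_nonneg _) hσ3).trans (h1.trans (by linarith))
  · exact (le_mul_of_one_le_right (abs_nonneg _) hσ).trans (h2.trans (by linarith))
  · refine h3.trans ?_
    gcongr
    · norm_num
    · exact le_self_pow₀ hσ (by norm_num)
  · exact h4

theorem card_cuspBlock_le (s : Bool) {σ T : ℝ} (hσ : 1 ≤ σ) (hT : 0 ≤ T) :
    ((cuspBlock s σ T).ncard : ℝ) ≤ 3000000 * T ^ 4 / σ := by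
  have hσ0 : 0 < σ := by linarith
  have hfin := finite_cuspBlock s hσ hT
  rw [Set.ncard_eq_toFinset_card _ hfin]
  by_cases hTσ : T < σ ^ 3
  · have : cuspBlock s σ T = ∅ := by
      refine Set.eq_empty_of_forall_notMem ?_
      rintro f ⟨h0, h1, -⟩
      have : (1 : ℝ) ≤ |(f.a : ℝ)| := by exact_mod_cast Int.one_le_abs h0
      nlinarith [pow_pos hσ0 3]
    simp only [this, Set.Finite.toFinset_empty, Finset.card_empty, Nat.cast_zero]
    positivity
  push Not at hTσ
  have hT1 : 1 ≤ T / σ := by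
    rw [le_div_iff₀ hσ0, one_mul]
    exact (le_self_pow₀ hσ (by norm_num)).trans hTσ
  have hT0 : 1 ≤ T := (one_le_pow₀ hσ).trans hTσ
  have hT2 : 1 ≤ T * σ := one_le_mul_of_one_le_of_one_le hT0 hσ
  have hbc {f : BCF} (hf : f ∈ cuspBlock s σ T) :
      |(f.b : ℝ)| ≤ 14 * (T / σ) ∧ |(f.c : ℝ)| ≤ 61 * (T * σ) := by
    refine ⟨?_, by linarith [hf.2.2.2.1]⟩
    rw [← mul_div_assoc, le_div_iff₀ hσ0]
    exact hf.2.2.1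
  have hBC : (2 * (14 * (T / σ)) + 1) * (2 * (61 * (T * σ)) + 1) ≤ 3567 * T ^ 2 := by
    calc _ ≤ (29 * (T / σ)) * (123 * (T * σ)) := by gcongr <;> linarith
      _ = 3567 * T ^ 2 := by field_simp; ring
  set S := hfin.toFinset with hS
  have hmem {f : BCF} (hf : f ∈ S) : f ∈ cuspBlock s σ T := hfin.mem_toFinset.1 hf
  have hsmall : ((S.filter fun f => |(f.a : ℝ)| ≤ T / σ ^ 4).card : ℝ) ≤
      (185 * (T * σ ^ 3)) * (2 * (T / σ ^ 4) * (3567 * T ^ 2)) := by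
    have h := BCF.card_le_of_interval (S := S.filter fun f => |(f.a : ℝ)| ≤ T / σ ^ 4)
      (A := T / σ ^ 4) (B := 14 * (T / σ)) (C := 61 * (T * σ)) (l := 184 * (T * σ ^ 3))
      (by positivity) (by positivity) (by positivity) (by positivity) (by
        intro f hf
        rw [Finset.mem_filter] at hf
        exact ⟨(hmem hf.1).1, hf.2, hbc (hmem hf.1)⟩) (by
        intro a b c
        refine ⟨-(92 * T * σ ^ 3), fun f hf _ _ _ => ?_⟩
        rw [Finset.mem_filter] at hf
        have := abs_le.1 (hmem hf.1).2.2.2.2.1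
        exact ⟨this.1, by linarith [this.2]⟩)
    refine h.trans ?_
    have : 1 ≤ T * σ ^ 3 := one_le_mul_of_one_le_of_one_le hT0 (one_le_pow₀ hσ)
    gcongr
    linarith
  have hlarge : ((S.filter fun f => ¬ |(f.a : ℝ)| ≤ T / σ ^ 4).card : ℝ) ≤
      (161 * (T * σ ^ 2)) * (2 * (T / σ ^ 3) * (3567 * T ^ 2)) := by
    have h := BCF.card_le_of_interval (S := S.filter fun f => ¬ |(f.a : ℝ)| ≤ T / σ ^ 4)
      (A := T / σ ^ 3) (B := 14 * (T / σ)) (C := 61 * (T * σ)) (l := 160 * (T * σ ^ 2))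
      (by positivity) (by positivity) (by positivity) (by positivity) (by
        intro f hf
        rw [Finset.mem_filter] at hf
        exact ⟨(hmem hf.1).1, (le_div_iff₀ (by positivity)).2 (hmem hf.1).2.1, hbc (hmem hf.1)⟩) (by
        intro a b c
        refine ⟨cEta s * b * c / a - 80 * (T * σ ^ 2), ?_⟩
        rintro f hf rfl rfl rfl
        rw [Finset.mem_filter, not_le, div_lt_iff₀ (by positivity)] at hf
        have ha : (f.a : ℝ) ≠ 0 := Int.cast_ne_zero.2 (hmem hf.1).1
        have h5 := (hmem hf.1).2.2.2.2.2
        have h6 : |(f.d : ℝ) - cEta s * f.b * f.c / f.a| ≤ 80 * (T * σ ^ 2) := by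
          have e : (f.a * f.d - cEta s * f.b * f.c : ℝ) =
              f.a * (f.d - cEta s * f.b * f.c / f.a) := by field_simp
          rw [e, abs_mul] at h5
          set D := |(f.d : ℝ) - cEta s * f.b * f.c / f.a|
          have hD : 0 ≤ D := abs_nonneg _
          have h7 : T * D ≤ T * (80 * (T * σ ^ 2)) := by
            calc T * D ≤ |(f.a : ℝ)| * σ ^ 4 * D := by gcongr; exact hf.2.le
              _ = |(f.a : ℝ)| * D * σ ^ 2 * σ ^ 2 := by ring
              _ ≤ 80 * T ^ 2 * σ ^ 2 := by gcongr
              _ = T * (80 * (T * σ ^ 2)) := by ring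
          exact le_of_mul_le_mul_left h7 (by linarith)
        have := abs_le.1 h6
        exact ⟨by linarith [this.1], by linarith [this.2]⟩)
    refine h.trans ?_
    have : 1 ≤ T * σ ^ 2 := one_le_mul_of_one_le_of_one_le hT0 (one_le_pow₀ hσ)
    gcongr
    linarith
  rw [← Finset.card_filter_add_card_filter_not (s := S) (fun f => |(f.a : ℝ)| ≤ T / σ ^ 4)]
  push_cast
  have e1 : (185 * (T * σ ^ 3)) * (2 * (T / σ ^ 4) * (3567 * T ^ 2)) =
      (185 * 2 * 3567) * T ^ 4 / σ := by field_simp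
  have e2 : (161 * (T * σ ^ 2)) * (2 * (T / σ ^ 3) * (3567 * T ^ 2)) =
      (161 * 2 * 3567) * T ^ 4 / σ := by field_simp
  rw [e1] at hsmall
  rw [e2] at hlarge
  refine (add_le_add hsmall hlarge).trans ?_
  rw [← add_div, ← add_mul]
  gcongr
  norm_num

theorem cubicParam_bounds (s : Bool) {w : Fin 4 → ℝ} {r : ℝ} (hp : |w 0| ≤ r) (hq : |w 1| ≤ r)
    (hx : |w 2| ≤ 1 / 2) {σ : ℝ} (hσ : 1 ≤ σ) (hy0 : 0 < w 3) (hy : w 3 ≤ 4 * σ ^ 2) :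
    |cubicParam s w 1| ≤ 14 * (r * σ ^ 2) ∧ |cubicParam s w 2| ≤ 61 * (r * σ ^ 4) ∧
      |cubicParam s w 3| ≤ 92 * (r * σ ^ 6) := by
  have hB : |cB s| ≤ 3 := by cases s <;> norm_num [cB]
  have hC : |cC s| ≤ 3 := by cases s <;> norm_num [cC]
  have hD : |cD s| ≤ 1 := by cases s <;> norm_num [cD]
  have hr : 0 ≤ r := (abs_nonneg _).trans hp
  have h3 : |w 3| ≤ 4 * σ ^ 2 := by rwa [abs_of_pos hy0]
  have hσ2 : 1 ≤ σ ^ 2 := one_le_pow₀ hσ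
  have hσ4 : 1 ≤ σ ^ 4 := one_le_pow₀ hσ
  have hσ24 : σ ^ 2 ≤ σ ^ 4 := pow_le_pow_right₀ hσ (by norm_num)
  have hσ46 : σ ^ 4 ≤ σ ^ 6 := pow_le_pow_right₀ hσ (by norm_num)
  have m1 : r ≤ r * σ ^ 2 := le_mul_of_one_le_right hr hσ2
  have m2 : r * σ ^ 2 ≤ r * σ ^ 4 := by gcongr
  have m3 : r * σ ^ 4 ≤ r * σ ^ 6 := by gcongr
  refine ⟨?_, ?_, ?_⟩
  · simp only [cubicParam, Matrix.cons_val_one, Matrix.cons_val_zero]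
    calc |-3 * w 2 * w 0 + cB s * w 1 * w 3| ≤ |-3 * w 2 * w 0| + |cB s * w 1 * w 3| :=
          abs_add_le _ _
      _ = 3 * |w 2| * |w 0| + |cB s| * |w 1| * |w 3| := by simp [abs_mul]
      _ ≤ 3 * (1 / 2) * r + 3 * r * (4 * σ ^ 2) := by gcongr
      _ ≤ 14 * (r * σ ^ 2) := by linarith
  · simp only [cubicParam, Matrix.cons_val]
    calc |3 * w 2 ^ 2 * w 0 - 2 * w 2 * cB s * w 1 * w 3 + cC s * w 0 * w 3 ^ 2|
        ≤ |3 * w 2 ^ 2 * w 0| + |2 * w 2 * cB s * w 1 * w 3| + |cC s * w 0 * w 3 ^ 2| :=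
          (abs_add_le _ _).trans (add_le_add_left (abs_sub _ _) _)
      _ = 3 * |w 2| ^ 2 * |w 0| + 2 * |w 2| * |cB s| * |w 1| * |w 3| +
          |cC s| * |w 0| * |w 3| ^ 2 := by simp [abs_mul]
      _ ≤ 3 * (1 / 2) ^ 2 * r + 2 * (1 / 2) * 3 * r * (4 * σ ^ 2) + 3 * r * (4 * σ ^ 2) ^ 2 := by
          gcongr
      _ ≤ 61 * (r * σ ^ 4) := by
          have : 3 * r * (4 * σ ^ 2) ^ 2 = 48 * (r * σ ^ 4) := by ring
          linarith
  · simp only [cubicParam, Matrix.cons_val]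
    calc |-w 2 ^ 3 * w 0 + w 2 ^ 2 * cB s * w 1 * w 3 - w 2 * cC s * w 0 * w 3 ^ 2 +
          cD s * w 1 * w 3 ^ 3|
        ≤ |-w 2 ^ 3 * w 0| + |w 2 ^ 2 * cB s * w 1 * w 3| + |w 2 * cC s * w 0 * w 3 ^ 2| +
          |cD s * w 1 * w 3 ^ 3| :=
          (abs_add_le _ _).trans (add_le_add_left ((abs_sub _ _).trans
            (add_le_add_left (abs_add_le _ _) _)) _)
      _ = |w 2| ^ 3 * |w 0| + |w 2| ^ 2 * |cB s| * |w 1| * |w 3| +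
          |w 2| * |cC s| * |w 0| * |w 3| ^ 2 + |cD s| * |w 1| * |w 3| ^ 3 := by simp [abs_mul]
      _ ≤ (1 / 2) ^ 3 * r + (1 / 2) ^ 2 * 3 * r * (4 * σ ^ 2) +
          (1 / 2) * 3 * r * (4 * σ ^ 2) ^ 2 + 1 * r * (4 * σ ^ 2) ^ 3 := by gcongr
      _ = 1 / 8 * r + 3 * (r * σ ^ 2) + 24 * (r * σ ^ 4) + 64 * (r * σ ^ 6) := by ring
      _ ≤ 92 * (r * σ ^ 6) := by linarith [mul_nonneg hr (by positivity : 0 ≤ σ ^ 6)]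

theorem cubicParam_cancel (s : Bool) {w : Fin 4 → ℝ} {r : ℝ} (hp : |w 0| ≤ r) (hq : |w 1| ≤ r)
    (hx : |w 2| ≤ 1 / 2) (hy : 1 ≤ w 3) :
    |cubicParam s w 0 * cubicParam s w 3 - cEta s * cubicParam s w 1 * cubicParam s w 2| ≤
      5 * (r ^ 2 * w 3 ^ 2) := by
  have hr : 0 ≤ r := (abs_nonneg _).trans hp
  have h3 : |w 3| = w 3 := abs_of_pos (by linarith)
  have hy2 : w 3 ≤ w 3 ^ 2 := le_self_pow₀ hy (by norm_num)
  have m1 : r ^ 2 * w 3 ≤ r ^ 2 * w 3 ^ 2 := by gcongr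
  have m2 : r ^ 2 ≤ r ^ 2 * w 3 := le_mul_of_one_le_right (by positivity) hy
  cases s
  · have e : cubicParam false w 0 * cubicParam false w 3 -
        cEta false * cubicParam false w 1 * cubicParam false w 2 =
        8 * w 2 ^ 3 * w 0 ^ 2 - 8 * w 2 ^ 2 * w 0 * w 1 * w 3 + 2 * w 2 * w 0 ^ 2 * w 3 ^ 2 +
          2 * w 2 * w 1 ^ 2 * w 3 ^ 2 := by
      simp only [cubicParam, Matrix.cons_val, Matrix.cons_val_zero, Matrix.cons_val_one, cB, cC, cD,
        cEta]
      ring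
    rw [e]
    calc _ ≤ |8 * w 2 ^ 3 * w 0 ^ 2| + |8 * w 2 ^ 2 * w 0 * w 1 * w 3| +
          |2 * w 2 * w 0 ^ 2 * w 3 ^ 2| + |2 * w 2 * w 1 ^ 2 * w 3 ^ 2| :=
          (abs_add_le _ _).trans (add_le_add_left ((abs_add_le _ _).trans
            (add_le_add_left (abs_sub _ _) _)) _)
      _ = 8 * |w 2| ^ 3 * |w 0| ^ 2 + 8 * |w 2| ^ 2 * |w 0| * |w 1| * |w 3| +
          2 * |w 2| * |w 0| ^ 2 * |w 3| ^ 2 + 2 * |w 2| * |w 1| ^ 2 * |w 3| ^ 2 := by simp [abs_mul]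
      _ ≤ 8 * (1 / 2) ^ 3 * r ^ 2 + 8 * (1 / 2) ^ 2 * r * r * w 3 +
          2 * (1 / 2) * r ^ 2 * w 3 ^ 2 + 2 * (1 / 2) * r ^ 2 * w 3 ^ 2 := by
          rw [h3]
          gcongr
      _ = r ^ 2 + 2 * (r ^ 2 * w 3) + 2 * (r ^ 2 * w 3 ^ 2) := by ring
      _ ≤ 5 * (r ^ 2 * w 3 ^ 2) := by linarith
  · have e : cubicParam true w 0 * cubicParam true w 3 -
        cEta true * cubicParam true w 1 * cubicParam true w 2 =
        2 * w 2 * w 0 ^ 2 * w 3 ^ 2 + 2 * w 2 * w 1 ^ 2 * w 3 ^ 2 := by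
      simp only [cubicParam, Matrix.cons_val, Matrix.cons_val_zero, Matrix.cons_val_one, cB, cC, cD,
        cEta]
      ring
    rw [e]
    calc _ ≤ |2 * w 2 * w 0 ^ 2 * w 3 ^ 2| + |2 * w 2 * w 1 ^ 2 * w 3 ^ 2| := abs_add_le _ _
      _ = 2 * |w 2| * |w 0| ^ 2 * |w 3| ^ 2 + 2 * |w 2| * |w 1| ^ 2 * |w 3| ^ 2 := by simp [abs_mul]
      _ ≤ 2 * (1 / 2) * r ^ 2 * w 3 ^ 2 + 2 * (1 / 2) * r ^ 2 * w 3 ^ 2 := by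
          rw [h3]
          gcongr
      _ ≤ 5 * (r ^ 2 * w 3 ^ 2) := by linarith [show 0 ≤ r ^ 2 * w 3 ^ 2 by positivity]

theorem mem_cuspBlock {s : Bool} {f : BCF} {x y σ T : ℝ} (hT : 0 ≤ T) (hσ : 1 ≤ σ) (ha : f.a ≠ 0)
    (hx : |x| ≤ 1 / 2) (hy1 : σ ^ 2 ≤ y) (hy2 : y ≤ 4 * σ ^ 2)
    (h : IsCovariant s f.vec x (x ^ 2 + y ^ 2)) (hd : |(f.disc : ℝ)| ≤ T ^ 4) :
    f ∈ cuspBlock s σ T := by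
  have hσ0 : 0 < σ := by linarith
  have hy0 : 0 < y := by nlinarith
  have hy1' : 1 ≤ y := (one_le_pow₀ hσ).trans hy1
  have hv := h.eq_cubicParam hy0
  set w := ![f.vec 0, (f.vec 1 + 3 * x * f.vec 0) / (cB s * y), x, y]
  have hw2 : w 2 = x := rfl
  have hw3 : w 3 = y := rfl
  rw [← realDisc_vec, hv, abs_realDisc_cubicParam, hw3] at hd
  set r := √(w 0 ^ 2 + w 1 ^ 2)
  have hr0 : 0 ≤ r := Real.sqrt_nonneg _
  have hr2 : r ^ 2 = w 0 ^ 2 + w 1 ^ 2 := Real.sq_sqrt (by positivity)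
  have hp : |w 0| ≤ r := Real.abs_le_sqrt (by linarith [sq_nonneg (w 1)])
  have hq : |w 1| ≤ r := Real.abs_le_sqrt (by linarith [sq_nonneg (w 0)])
  have hrT : r * σ ^ 3 ≤ T := by
    refine le_of_pow_le_pow_left₀ four_ne_zero hT ?_
    calc (r * σ ^ 3) ^ 4 = 1 * (σ ^ 2) ^ 6 * (r ^ 2) ^ 2 := by ring
      _ ≤ |cS s| * y ^ 6 * (r ^ 2) ^ 2 := by
          gcongr
          linarith [four_le_abs_cS s]
      _ ≤ T ^ 4 := by rwa [hr2]
  obtain ⟨b1, b2, b3⟩ := cubicParam_bounds s hp hq hx hσ hy0 hy2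
  have b4 := cubicParam_cancel s hp hq hx hy1'
  rw [← hv] at b1 b2 b3 b4
  have e0 : f.vec 0 = f.a := rfl
  have e1 : f.vec 1 = f.b := rfl
  have e2 : f.vec 2 = f.c := rfl
  have e3 : f.vec 3 = f.d := rfl
  rw [e0, e1, e2, e3] at b4
  rw [e1] at b1
  rw [e2] at b2
  rw [e3] at b3
  refine ⟨ha, ?_, ?_, ?_, ?_, ?_⟩
  · exact le_trans (by gcongr; exact hp) hrT
  · calc |(f.b : ℝ)| * σ ≤ 14 * (r * σ ^ 2) * σ := by gcongr
      _ = 14 * (r * σ ^ 3) := by ring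
      _ ≤ 14 * T := by gcongr
  · calc |(f.c : ℝ)| ≤ 61 * (r * σ ^ 4) := b2
      _ = 61 * (r * σ ^ 3) * σ := by ring
      _ ≤ 61 * T * σ := by gcongr
  · calc |(f.d : ℝ)| ≤ 92 * (r * σ ^ 6) := b3
      _ = 92 * (r * σ ^ 3) * σ ^ 3 := by ring
      _ ≤ 92 * T * σ ^ 3 := by gcongr
  · calc _ ≤ 5 * (r ^ 2 * y ^ 2) * σ ^ 2 := by gcongr; exact b4
      _ ≤ 5 * (r ^ 2 * (4 * σ ^ 2) ^ 2) * σ ^ 2 := by gcongr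
      _ = 80 * (r * σ ^ 3) ^ 2 := by ring
      _ ≤ 80 * T ^ 2 := by gcongr

/-- Reduced forms of height at least `Y` and discriminant at most `T⁴`. -/
def cuspForms (s : Bool) (Y T : ℝ) : Set BCF :=
  {f | f.a ≠ 0 ∧ |(f.disc : ℝ)| ≤ T ^ 4 ∧ ∃ x y : ℝ, |x| ≤ 1 / 2 ∧ Y ≤ y ∧
    IsCovariant s f.vec x (x ^ 2 + y ^ 2)}

theorem cuspForms_subset (s : Bool) {ρ T : ℝ} (hρ : 1 ≤ ρ) (hT : 0 ≤ T) :
    cuspForms s (ρ ^ 2) T ⊆ ⋃ k ∈ Finset.range (⌈T⌉₊), cuspBlock s (2 ^ k * ρ) T := by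
  rintro f ⟨ha, hd, x, y, hx, hy, h⟩
  have hρ0 : 0 < ρ := by linarith
  obtain ⟨k, hk1, hk2⟩ := exists_nat_pow_near ((one_le_div (by positivity)).2 hy)
    (by norm_num : (1 : ℝ) < 4)
  rw [le_div_iff₀ (by positivity)] at hk1
  rw [div_lt_iff₀ (by positivity)] at hk2
  have h2k : (1 : ℝ) ≤ 2 ^ k := one_le_pow₀ (by norm_num)
  have hσ : 1 ≤ 2 ^ k * ρ := one_le_mul_of_one_le_of_one_le h2k hρ
  have e4 : (2 ^ k * ρ) ^ 2 = 4 ^ k * ρ ^ 2 := by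
    rw [mul_pow, ← pow_mul, mul_comm k 2, pow_mul]; norm_num
  have hmem : f ∈ cuspBlock s (2 ^ k * ρ) T := by
    refine mem_cuspBlock hT hσ ha hx (e4 ▸ hk1) ?_ h hd
    rw [e4]
    rw [pow_succ] at hk2
    linarith
  refine Set.mem_iUnion₂.2 ⟨k, ?_, hmem⟩
  rw [Finset.mem_range, Nat.lt_ceil]
  have h1 : (1 : ℝ) ≤ |(f.a : ℝ)| := by exact_mod_cast Int.one_le_abs ha
  calc (k : ℝ) < 2 ^ k := by exact_mod_cast Nat.lt_two_pow_self
    _ ≤ 2 ^ k * ρ := le_mul_of_one_le_right (by positivity) hρ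
    _ ≤ (2 ^ k * ρ) ^ 3 := le_self_pow₀ hσ (by norm_num)
    _ ≤ |(f.a : ℝ)| * (2 ^ k * ρ) ^ 3 := le_mul_of_one_le_left (by positivity) h1
    _ ≤ T := hmem.2.1

theorem finite_cuspForms (s : Bool) {ρ T : ℝ} (hρ : 1 ≤ ρ) (hT : 0 ≤ T) :
    (cuspForms s (ρ ^ 2) T).Finite := by
  refine (Set.Finite.biUnion (Finset.finite_toSet _) fun k _ => ?_).subset
    (cuspForms_subset s hρ hT)
  exact finite_cuspBlock s (one_le_mul_of_one_le_of_one_le (one_le_pow₀ (by norm_num)) hρ) hT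

theorem card_cuspForms_le (s : Bool) {ρ T : ℝ} (hρ : 1 ≤ ρ) (hT : 0 ≤ T) :
    ((cuspForms s (ρ ^ 2) T).ncard : ℝ) ≤ 6000000 * T ^ 4 / ρ := by
  have hρ0 : 0 < ρ := by linarith
  have hσ (k : ℕ) : 1 ≤ 2 ^ k * ρ :=
    one_le_mul_of_one_le_of_one_le (one_le_pow₀ (by norm_num)) hρ
  have h1 : (cuspForms s (ρ ^ 2) T).ncard ≤
      ∑ k ∈ Finset.range ⌈T⌉₊, (cuspBlock s (2 ^ k * ρ) T).ncard := by
    rw [Set.ncard_eq_toFinset_card _ (finite_cuspForms s hρ hT)]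
    refine le_trans (Finset.card_le_card (t := (Finset.range ⌈T⌉₊).biUnion fun k =>
      (finite_cuspBlock s (hσ k) hT).toFinset) fun f hf => ?_) (Finset.card_biUnion_le.trans ?_)
    · simpa using cuspForms_subset s hρ hT ((Set.Finite.mem_toFinset _).1 hf)
    · refine Finset.sum_le_sum fun k _ => ?_
      rw [Set.ncard_eq_toFinset_card _ (finite_cuspBlock s (hσ k) hT)]
  calc ((cuspForms s (ρ ^ 2) T).ncard : ℝ)
      ≤ ∑ k ∈ Finset.range ⌈T⌉₊, ((cuspBlock s (2 ^ k * ρ) T).ncard : ℝ) := by exact_mod_cast h1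
    _ ≤ ∑ k ∈ Finset.range ⌈T⌉₊, 3000000 * T ^ 4 / (2 ^ k * ρ) :=
        Finset.sum_le_sum fun k _ => card_cuspBlock_le s (hσ k) hT
    _ = (∑ k ∈ Finset.range ⌈T⌉₊, (1 / 2 : ℝ) ^ k) * (3000000 * T ^ 4 / ρ) := by
        rw [Finset.sum_mul]
        refine Finset.sum_congr rfl fun k _ => ?_
        rw [div_pow, one_pow]
        field_simp
    _ ≤ 2 * (3000000 * T ^ 4 / ρ) := by
        gcongr
        exact sum_geometric_two_le _
    _ = 6000000 * T ^ 4 / ρ := by ring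

/-- Factorizations `(n, m)` of nonzero integers of absolute value at most `A`, with `n`
positive. -/
noncomputable def factorPairs (A : ℝ) : Finset (Σ _ : ℕ, ℤ) :=
  (Finset.Icc 1 ⌊A⌋₊).sigma fun n => (Finset.Icc (-⌊A / n⌋) ⌊A / n⌋).erase 0

theorem one_add_log_le_four_mul {A : ℝ} (hA : 1 ≤ A) : 1 + Real.log A ≤ 4 * √(√A) := by
  have h0 : (0 : ℝ) ≤ A := by linarith
  have h1 : 0 < √(√A) := Real.sqrt_pos.2 (Real.sqrt_pos.2 (by linarith))
  have h2 := Real.log_le_sub_one_of_pos h1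
  rw [Real.log_sqrt (Real.sqrt_nonneg _), Real.log_sqrt h0] at h2
  linarith

theorem card_factorPairs_le {A : ℝ} (hA : 1 ≤ A) :
    ((factorPairs A).card : ℝ) ≤ 8 * A * √(√A) := by
  have h0 : (0 : ℝ) ≤ A := by linarith
  have h1 : 1 ≤ ⌊A⌋₊ := Nat.one_le_floor_iff A |>.2 hA
  rw [factorPairs, Finset.card_sigma]
  push_cast
  calc ∑ n ∈ Finset.Icc 1 ⌊A⌋₊, (((Finset.Icc (-⌊A / n⌋) ⌊A / n⌋).erase 0).card : ℝ)
      ≤ ∑ n ∈ Finset.Icc 1 ⌊A⌋₊, 2 * A * (n : ℝ)⁻¹ := by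
        refine Finset.sum_le_sum fun n _ => ?_
        refine (Int.natCast_card_Icc_floor_erase_le (A / n) (by positivity)).trans_eq ?_
        rw [div_eq_mul_inv, mul_assoc]
    _ = 2 * A * ((harmonic ⌊A⌋₊ : ℚ) : ℝ) := by
        rw [← Finset.mul_sum, harmonic_eq_sum_Icc]
        push_cast
        rfl
    _ ≤ 2 * A * (1 + Real.log A) := by
        gcongr
        refine (harmonic_le_one_add_log _).trans ?_
        gcongr
        exact Nat.floor_le h0
    _ ≤ 2 * A * (4 * √(√A)) := by
        gcongr
        exact one_add_log_le_four_mul hA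
    _ = 8 * A * √(√A) := by ring

theorem mem_factorPairs {A : ℝ} {n : ℕ} {m : ℤ} (hn : 0 < n) (hm : m ≠ 0)
    (h : |((n * m : ℤ) : ℝ)| ≤ A) : (⟨n, m⟩ : Σ _ : ℕ, ℤ) ∈ factorPairs A := by
  push_cast at h
  rw [abs_mul, Nat.abs_cast] at h
  have hn' : (0 : ℝ) < n := by exact_mod_cast hn
  have hm' : (1 : ℝ) ≤ |(m : ℝ)| := by exact_mod_cast Int.one_le_abs hm
  rw [factorPairs, Finset.mem_sigma, Finset.mem_Icc, Finset.mem_erase]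
  refine ⟨⟨hn, Nat.le_floor (le_trans ?_ h)⟩, hm, Int.mem_Icc_floor_of_abs_le ?_⟩
  · exact le_mul_of_one_le_right hn'.le hm'
  · rwa [le_div_iff₀ hn', mul_comm]

namespace BCF

/-- The form with given outer factorizations, given `b` and a zero at `(±m, n)`. -/
def ofFactors (p : ℤ × (Σ _ : ℕ, ℤ) × (Σ _ : ℕ, ℤ) × ℤˣ) : BCF where
  a := p.2.1.1 * p.2.1.2
  b := p.1
  c := -(p.2.1.1 * p.2.1.2 * (p.2.2.2 * p.2.2.1.1) ^ 3
    + p.1 * (p.2.2.2 * p.2.2.1.1) ^ 2 * p.2.1.1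
    + p.2.2.1.1 * p.2.2.1.2 * p.2.1.1 ^ 3) / ((p.2.2.2 * p.2.2.1.1) * p.2.1.1 ^ 2)
  d := p.2.2.1.1 * p.2.2.1.2

theorem exists_coprime_zero {f : BCF} (hf : ¬ f.Aniso) (ha : f.a ≠ 0) (hd : f.d ≠ 0) :
    ∃ r s : ℤ, IsCoprime r s ∧ r ≠ 0 ∧ 0 < s ∧ f.eval r s = 0 := by
  simp only [Aniso, not_forall] at hf
  obtain ⟨r, s, h0, hrs⟩ := hf
  have hs : s ≠ 0 := by
    rintro rfl
    apply hrs
    simpa [eval, ha] using h0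
  have hr : r ≠ 0 := by
    rintro rfl
    apply hrs
    simpa [eval, hd] using h0
  obtain ⟨g, r', s', hg, hc, rfl, rfl⟩ := Int.exists_gcd_one' (Int.gcd_pos_of_ne_zero_left s hr)
  have hg' : (g : ℤ) ≠ 0 := by exact_mod_cast hg.ne'
  have hc' : IsCoprime r' s' := Int.isCoprime_iff_gcd_eq_one.2 hc
  have hr' : r' ≠ 0 := left_ne_zero_of_mul hr
  have hs' : s' ≠ 0 := left_ne_zero_of_mul hs
  have h1 : f.eval r' s' = 0 := by
    have : (g : ℤ) ^ 3 * f.eval r' s' = 0 := by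
      rw [← h0]; simp only [eval]; ring
    exact (mul_eq_zero.1 this).resolve_left (pow_ne_zero 3 hg')
  rcases lt_or_gt_of_ne hs' with h | h
  · refine ⟨-r', -s', hc'.neg_neg, neg_ne_zero.2 hr', by linarith, ?_⟩
    rw [← neg_eq_zero, ← h1]; simp only [eval]; ring
  · exact ⟨r', s', hc', hr', h, h1⟩

theorem exists_ofFactors {f : BCF} (hf : ¬ f.Aniso) (ha : f.a ≠ 0) (hd : f.d ≠ 0) {A : ℝ}
    (hA : |(f.a : ℝ)| ≤ A) (hB : |(f.b : ℝ)| ≤ A) (hD : |(f.d : ℝ)| ≤ A) :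
    ∃ p ∈ Finset.Icc (-⌊A⌋) ⌊A⌋ ×ˢ factorPairs A ×ˢ factorPairs A ×ˢ
      (Finset.univ : Finset ℤˣ), ofFactors p = f := by
  obtain ⟨r, s, hrs, hr, hs, h0⟩ := exists_coprime_zero hf ha hd
  rw [eval] at h0
  have h1 : s ∣ f.a := by
    refine (hrs.symm.pow_right (n := 3)).dvd_of_dvd_mul_right
      ⟨-(f.b * r ^ 2 + f.c * r * s + f.d * s ^ 2), ?_⟩
    linear_combination h0
  have h2 : r ∣ f.d := by
    refine (hrs.pow_right (n := 3)).dvd_of_dvd_mul_right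
      ⟨-(f.a * r ^ 2 + f.b * r * s + f.c * s ^ 2), ?_⟩
    linear_combination h0
  lift s to ℕ using hs.le
  obtain ⟨a', ha'⟩ := h1
  obtain ⟨d', hd'⟩ := Int.natAbs_dvd.2 h2
  obtain ⟨ε, hε⟩ : ∃ ε : ℤˣ, r = ε * r.natAbs := by
    rcases Int.natAbs_eq r with h | h
    · exact ⟨1, by simpa using h⟩
    · exact ⟨-1, by simpa using h⟩
  refine ⟨⟨f.b, ⟨s, a'⟩, ⟨r.natAbs, d'⟩, ε⟩, ?_, ?_⟩
  · simp only [Finset.mem_product, Finset.mem_univ, and_true]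
    refine ⟨Int.mem_Icc_floor_of_abs_le hB, mem_factorPairs (by exact_mod_cast hs) ?_ ?_,
      mem_factorPairs (Int.natAbs_pos.2 hr) ?_ ?_⟩
    · rintro rfl; simp [ha] at ha'
    · rwa [← ha']
    · rintro rfl; simp [hd] at hd'
    · rwa [← hd']
  · obtain ⟨a, b, c, d⟩ := f
    simp only at *
    simp only [ofFactors, BCF.mk.injEq, ← ha', ← hd', ← hε, true_and, and_true]
    refine Int.ediv_eq_of_eq_mul_right (mul_ne_zero hr (pow_ne_zero 2 hs.ne')) ?_
    linear_combination -h0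

/-- Forms with a zero leading or trailing coefficient in a box. -/
theorem card_le_of_outer_zero {S : Finset BCF} {A : ℝ} (hA : 0 ≤ A)
    (h : ∀ f ∈ S, |(f.a : ℝ)| ≤ A ∧ |(f.b : ℝ)| ≤ A ∧ |(f.c : ℝ)| ≤ A ∧ |(f.d : ℝ)| ≤ A)
    (h0 : ∀ f ∈ S, f.a = 0 ∨ f.d = 0) : (S.card : ℝ) ≤ 2 * (2 * A + 1) ^ 3 := by
  set I := Finset.Icc (-⌊A⌋) ⌊A⌋ with hI
  have hsub : S ⊆ ((I ×ˢ I ×ˢ I).image fun p => (⟨0, p.1, p.2.1, p.2.2⟩ : BCF)) ∪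
      ((I ×ˢ I ×ˢ I).image fun p => (⟨p.1, p.2.1, p.2.2, 0⟩ : BCF)) := by
    rintro ⟨a, b, c, d⟩ hf
    obtain ⟨ha, hb, hc, hd⟩ := h _ hf
    replace ha := Int.mem_Icc_floor_of_abs_le ha
    replace hb := Int.mem_Icc_floor_of_abs_le hb
    replace hc := Int.mem_Icc_floor_of_abs_le hc
    replace hd := Int.mem_Icc_floor_of_abs_le hd
    simp only [Finset.mem_union, Finset.mem_image, Finset.mem_product]
    rcases h0 _ hf with h | h
    · exact Or.inl ⟨(b, c, d), ⟨hb, hc, hd⟩, by simp_all⟩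
    · exact Or.inr ⟨(a, b, c), ⟨ha, hb, hc⟩, by simp_all⟩
  have h1 : S.card ≤ I.card ^ 3 + I.card ^ 3 := by
    refine (Finset.card_le_card hsub).trans ((Finset.card_union_le _ _).trans ?_)
    have : (I ×ˢ I ×ˢ I).card = I.card ^ 3 := by
      simp only [Finset.card_product]; ring
    exact add_le_add (Finset.card_image_le.trans_eq this) (Finset.card_image_le.trans_eq this)
  have h2 := Int.natCast_card_Icc_floor_le A hA
  calc (S.card : ℝ) ≤ (I.card : ℝ) ^ 3 + (I.card : ℝ) ^ 3 := by exact_mod_cast h1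
    _ ≤ (2 * A + 1) ^ 3 + (2 * A + 1) ^ 3 := by gcongr
    _ = 2 * (2 * A + 1) ^ 3 := by ring

theorem card_not_aniso_le {S : Finset BCF} {A : ℝ} (hA : 1 ≤ A)
    (h : ∀ f ∈ S, |(f.a : ℝ)| ≤ A ∧ |(f.b : ℝ)| ≤ A ∧ |(f.c : ℝ)| ≤ A ∧ |(f.d : ℝ)| ≤ A)
    (h0 : ∀ f ∈ S, ¬ f.Aniso) : (S.card : ℝ) ≤ 438 * (A ^ 3 * √A) := by
  have hA0 : (0 : ℝ) ≤ A := by linarith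
  rw [← Finset.card_filter_add_card_filter_not (s := S) fun f => f.a = 0 ∨ f.d = 0]
  push_cast
  have h1 : ((S.filter fun f => f.a = 0 ∨ f.d = 0).card : ℝ) ≤ 2 * (2 * A + 1) ^ 3 :=
    card_le_of_outer_zero hA0 (fun f hf => h f (Finset.mem_filter.1 hf).1)
      fun f hf => (Finset.mem_filter.1 hf).2
  have h2 : (S.filter fun f => ¬ (f.a = 0 ∨ f.d = 0)).card ≤
      (Finset.Icc (-⌊A⌋) ⌊A⌋ ×ˢ factorPairs A ×ˢ factorPairs A ×ˢ
        (Finset.univ : Finset ℤˣ)).card := by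
    refine (Finset.card_le_card ?_).trans (Finset.card_image_le (f := ofFactors))
    intro f hf
    obtain ⟨hf, had⟩ := Finset.mem_filter.1 hf
    push Not at had
    obtain ⟨ha, hb, -, hd⟩ := h f hf
    exact Finset.mem_image.2 (exists_ofFactors (h0 f hf) had.1 had.2 ha hb hd)
  simp only [Finset.card_product, Finset.card_univ, Fintype.card_units_int] at h2
  have h3 := card_factorPairs_le hA
  have h4 := Int.natCast_card_Icc_floor_le A hA0
  have h5 : √(√A) ^ 2 = √A := Real.sq_sqrt (Real.sqrt_nonneg _)
  have h6 : 1 ≤ √A := Real.one_le_sqrt.2 hA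
  calc _ ≤ 2 * (2 * A + 1) ^ 3 + (2 * A + 1) * ((8 * A * √(√A)) * ((8 * A * √(√A)) * 2)) := by
        refine add_le_add h1 ?_
        refine (Nat.cast_le (α := ℝ).2 h2).trans ?_
        push_cast
        gcongr
    _ = 2 * (2 * A + 1) ^ 3 + 128 * (2 * A + 1) * A ^ 2 * √A := by
        linear_combination 128 * (2 * A + 1) * A ^ 2 * h5
    _ ≤ 2 * (2 * A + A) ^ 3 * √A + 128 * (2 * A + A) * A ^ 2 * √A := by
        have : 2 * (2 * A + A) ^ 3 ≤ 2 * (2 * A + A) ^ 3 * √A :=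
          le_mul_of_one_le_right (by positivity) h6
        have : 2 * (2 * A + 1) ^ 3 ≤ 2 * (2 * A + A) ^ 3 := by gcongr
        have : 128 * (2 * A + 1) * A ^ 2 * √A ≤ 128 * (2 * A + A) * A ^ 2 * √A := by gcongr
        linarith
    _ = 438 * (A ^ 3 * √A) := by ring

end BCF

theorem tendsto_card_not_aniso {R : ℝ} (hR : 0 < R) :
    Tendsto (fun T : ℝ => ({f : BCF | ‖f.vec‖ ≤ R * T ∧ ¬ f.Aniso}.ncard : ℝ) / T ^ 4)
      atTop (𝓝 0) := by
  have hlim : Tendsto (fun T : ℝ => 438 * R ^ 4 / √(R * T)) atTop (𝓝 0) :=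
    tendsto_const_nhds.div_atTop
      (Real.tendsto_sqrt_atTop.comp (tendsto_id.const_mul_atTop hR))
  refine squeeze_zero' ?_ ?_ hlim
  · filter_upwards [eventually_gt_atTop 0] with T hT
    positivity
  · filter_upwards [eventually_ge_atTop R⁻¹, eventually_gt_atTop 0] with T hT hT0
    have hA : 1 ≤ R * T := by
      rwa [inv_le_iff_one_le_mul₀' hR] at hT
    have hfin : {f : BCF | ‖f.vec‖ ≤ R * T ∧ ¬ f.Aniso}.Finite :=
      BCF.finite_of_norm_vec_le fun f hf => hf.1
    have h := BCF.card_not_aniso_le (S := hfin.toFinset) hA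
      (fun f hf => by
        have h1 := (hfin.mem_toFinset.1 hf).1
        obtain ⟨ha, hb, hc, hd⟩ := f.abs_le_norm_vec
        exact ⟨ha.trans h1, hb.trans h1, hc.trans h1, hd.trans h1⟩)
      (fun f hf => (hfin.mem_toFinset.1 hf).2)
    rw [Set.ncard_eq_toFinset_card _ hfin]
    have hpos : 0 < √(R * T) := Real.sqrt_pos.2 (by linarith)
    rw [div_le_div_iff₀ (by positivity) hpos]
    calc _ ≤ 438 * ((R * T) ^ 3 * √(R * T)) * √(R * T) := by gcongr
      _ = 438 * (R * T) ^ 3 * (√(R * T) ^ 2) := by ring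
      _ = 438 * R ^ 4 * T ^ 4 := by rw [Real.sq_sqrt (by linarith)]; ring

/-- The condition `0 < ± disc < T ^ 4` on discriminants. -/
def DiscCond (s : Bool) (T : ℝ) (d : ℤ) : Prop := 0 < cS s * (d : ℝ) ∧ |(d : ℝ)| < T ^ 4

/-- Irreducible reduced forms of bounded discriminant. -/
def reducedForms (s : Bool) (T : ℝ) : Set BCF :=
  {f | f.Aniso ∧ Reduced s f ∧ DiscCond s T f.disc}

theorem reducedForms_subset (s : Bool) {ρ T : ℝ} (hT : 0 < T) :
    reducedForms s T ⊆
      formsIn (cubicParam s '' paramCDom s (ρ ^ 2)) T ∪ cuspForms s (ρ ^ 2) T := by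
  rintro f ⟨hf, ⟨x, y, hy, hx, hN, hc⟩, hd⟩
  rcases le_total y (ρ ^ 2) with h | h
  · exact Or.inl (mem_formsIn_paramCDom hT hy hx hN hc hd.2.le h)
  · exact Or.inr ⟨hf.a_ne_zero, hd.2.le, x, y, hx, h, hc⟩

theorem finite_formsIn_paramCDom (s : Bool) (Y : ℝ) {T : ℝ} (hT : 0 < T) :
    (formsIn (cubicParam s '' paramCDom s Y) T).Finite :=
  finite_formsIn hT (isCompact_image_paramCDom s Y).isBounded

theorem finite_reducedForms (s : Bool) {T : ℝ} (hT : 0 < T) : (reducedForms s T).Finite :=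
  ((finite_formsIn_paramCDom s (1 ^ 2) hT).union
    (finite_cuspForms s le_rfl hT.le)).subset (reducedForms_subset s hT)

theorem NV_le_card_reducedForms (s : Bool) {T : ℝ} (hT : 0 < T) :
    NV (DiscCond s T) ≤ (reducedForms s T).ncard / 4 := by
  have hfin := finite_reducedForms s hT
  have h := NV_le (P := DiscCond s T) (Γ := stabFD) (S := hfin.toFinset)
    (Finset.card_pos.1 (by rw [card_stabFD]; norm_num)) ?_ ?_
  · rwa [card_stabFD, ← Set.ncard_eq_toFinset_card _ hfin] at h
  · intro f hf hd
    obtain ⟨γ, hγ⟩ := exists_smul_reduced hf hd.1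
    refine ⟨γ, hfin.mem_toFinset.2 ⟨hf.smul γ, hγ, ?_⟩⟩
    rwa [BCF.disc_smul]
  · intro f hf γ hγ
    obtain ⟨h1, h2, h3⟩ := hfin.mem_toFinset.1 hf
    refine hfin.mem_toFinset.2 ⟨h1.smul γ, h2.smul hγ, ?_⟩
    rwa [BCF.disc_smul]

theorem card_le_NV (s : Bool) {T : ℝ} (hT : 0 < T) {S' : Finset BCF}
    (hS' : ∀ f ∈ S', f.Aniso ∧ StrictReduced s f ∧ DiscCond s T f.disc) :
    (S'.card : ℝ) / 4 ≤ NV (DiscCond s T) := by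
  have hfin := finite_reducedForms s hT
  have h := le_NV (P := DiscCond s T) (Γ := stabFD) (S := hfin.toFinset) (S' := S')
    (Finset.card_pos.1 (by rw [card_stabFD]; norm_num)) ?_ ?_ ?_ ?_
  · rwa [card_stabFD] at h
  · intro f hf hd
    obtain ⟨γ, hγ⟩ := exists_smul_reduced hf hd.1
    refine ⟨γ, hfin.mem_toFinset.2 ⟨hf.smul γ, hγ, ?_⟩⟩
    rwa [BCF.disc_smul]
  · intro f hf γ hγ
    obtain ⟨h1, h2, h3⟩ := hfin.mem_toFinset.1 hf
    refine hfin.mem_toFinset.2 ⟨h1.smul γ, h2.smul hγ, ?_⟩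
    rwa [BCF.disc_smul]
  · exact fun f hf => ⟨(hS' f hf).1, (hS' f hf).2.2⟩
  · intro f hf γ hγ
    obtain ⟨-, h1, h2⟩ := hS' f hf
    refine h1.mem_stabFD ?_ (hS' _ hγ).2.1
    intro h0
    simp [DiscCond, h0] at h2

theorem NV_upper (s : Bool) {ρ T : ℝ} (hρ : 1 ≤ ρ) (hT : 0 < T) :
    NV (DiscCond s T) / T ^ 4 ≤
      ((formsIn (cubicParam s '' paramCDom s (ρ ^ 2)) T).ncard : ℝ) / T ^ 4 / 4 +
        1500000 / ρ := by
  have h1 := NV_le_card_reducedForms s hT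
  have h2 := (Set.ncard_le_ncard (reducedForms_subset s (ρ := ρ) hT)
    ((finite_formsIn_paramCDom s _ hT).union (finite_cuspForms s hρ hT.le))).trans
    (Set.ncard_union_le _ _)
  have h3 := card_cuspForms_le s hρ hT.le
  have h2' : ((reducedForms s T).ncard : ℝ) ≤
      (formsIn (cubicParam s '' paramCDom s (ρ ^ 2)) T).ncard +
        (cuspForms s (ρ ^ 2) T).ncard := by exact_mod_cast h2
  rw [div_le_iff₀ (by positivity)]
  have h4 : (((formsIn (cubicParam s '' paramCDom s (ρ ^ 2)) T).ncard : ℝ) / T ^ 4 / 4 +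
        1500000 / ρ) * T ^ 4 =
      ((formsIn (cubicParam s '' paramCDom s (ρ ^ 2)) T).ncard : ℝ) / 4 +
        6000000 * T ^ 4 / ρ / 4 := by field_simp; ring
  rw [h4]
  linarith

theorem NV_lower (s : Bool) {Y R T : ℝ} (hT : 0 < T)
    (hR : cubicParam s '' paramDom s Y ⊆ Metric.closedBall 0 R) :
    (((formsIn (cubicParam s '' paramDom s Y) T).ncard : ℝ) / T ^ 4 -
      ({f : BCF | ‖f.vec‖ ≤ R * T ∧ ¬ f.Aniso}.ncard : ℝ) / T ^ 4) / 4 ≤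
      NV (DiscCond s T) / T ^ 4 := by
  have hfin := finite_formsIn hT (isBounded_image_paramDom s Y)
  have hfin' : {f : BCF | ‖f.vec‖ ≤ R * T ∧ ¬ f.Aniso}.Finite :=
    BCF.finite_of_norm_vec_le fun f hf => hf.1
  have h1 := card_le_NV s hT (S' := hfin.toFinset.filter BCF.Aniso) (fun f hf => by
    obtain ⟨h1, h2⟩ := Finset.mem_filter.1 hf
    obtain ⟨h3, h4⟩ := cS_mul_pos_of_mem hT (hfin.mem_toFinset.1 h1)
    exact ⟨h2, h3, h4⟩)
  have h2 : (hfin.toFinset.filter fun f => ¬ f.Aniso).card ≤ hfin'.toFinset.card := by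
    refine Finset.card_le_card fun f hf => ?_
    obtain ⟨h1, h2⟩ := Finset.mem_filter.1 hf
    exact hfin'.mem_toFinset.2 ⟨norm_vec_le_of_mem_formsIn hT hR (hfin.mem_toFinset.1 h1), h2⟩
  have h3 := Finset.card_filter_add_card_filter_not (s := hfin.toFinset) BCF.Aniso
  rw [Set.ncard_eq_toFinset_card _ hfin, Set.ncard_eq_toFinset_card _ hfin', ← sub_div,
    div_right_comm]
  gcongr
  refine le_trans ?_ h1
  gcongr
  have h2' : ((hfin.toFinset.filter fun f => ¬ f.Aniso).card : ℝ) ≤ hfin'.toFinset.card := by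
    exact_mod_cast h2
  have h3' : ((hfin.toFinset.filter BCF.Aniso).card : ℝ) +
      (hfin.toFinset.filter fun f => ¬ f.Aniso).card = hfin.toFinset.card := by
    exact_mod_cast h3
  linarith

theorem tendsto_NV (s : Bool) :
    Tendsto (fun T : ℝ => NV (DiscCond s T) / T ^ 4) atTop
      (𝓝 (volConst s * (Real.pi / 3) / 4)) := by
  have hlow : Tendsto (fun ρ : ℝ => volConst s * (Real.pi / 3 - 1 / ρ ^ 2) / 4) atTop
      (𝓝 (volConst s * (Real.pi / 3 - 0) / 4)) :=
    (((tendsto_const_nhds.div_atTop (tendsto_pow_atTop two_ne_zero)).const_sub _).const_mul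
      _).div_const _
  have hup : Tendsto (fun ρ : ℝ => volConst s * (Real.pi / 3 - 1 / ρ ^ 2) / 4 + 1500000 / ρ)
      atTop (𝓝 (volConst s * (Real.pi / 3 - 0) / 4 + 0)) :=
    hlow.add (tendsto_const_nhds.div_atTop tendsto_id)
  rw [sub_zero] at hlow hup
  rw [add_zero] at hup
  refine tendsto_order.2 ⟨fun b hb => ?_, fun b hb => ?_⟩
  · obtain ⟨ρ, hρ, hρ1⟩ := ((hlow.eventually_const_lt hb).and (eventually_ge_atTop 1)).exists
    obtain ⟨R, hR⟩ := (isBounded_image_paramDom s (ρ ^ 2)).subset_closedBall_lt 0 0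
    have h := ((tendsto_card_paramDom s (one_le_pow₀ hρ1 : 1 ≤ ρ ^ 2)).sub
      (tendsto_card_not_aniso hR.1)).div_const 4
    rw [sub_zero] at h
    filter_upwards [h.eventually_const_lt hρ, eventually_gt_atTop 0] with T h1 hT
    exact h1.trans_le (NV_lower s hT hR.2)
  · obtain ⟨ρ, hρ, hρ1⟩ := ((hup.eventually_lt_const hb).and (eventually_ge_atTop 1)).exists
    have h := ((tendsto_card_paramCDom s (one_le_pow₀ hρ1 : 1 ≤ ρ ^ 2)).div_const 4).add_const
      (1500000 / ρ)
    filter_upwards [h.eventually_lt_const hρ, eventually_gt_atTop 0] with T h1 hT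
    exact (NV_upper s hρ1 hT).trans_lt h1

theorem tendsto_NV_sub (s : Bool) {P : ℝ → ℤ → Prop}
    (hP : ∀ X d, P X d ↔ 0 < cS s * (d : ℝ) ∧ |(d : ℝ)| < X) {c : ℝ}
    (hc : volConst s * (Real.pi / 3) / 4 = c) :
    Tendsto (fun X : ℝ => (NV (P X) - c * X) / X) atTop (𝓝 0) := by
  have h := ((tendsto_NV s).comp
    (tendsto_rpow_atTop (by norm_num : (0 : ℝ) < 1 / 4))).sub_const c
  rw [hc, sub_self] at h
  refine h.congr' ?_
  filter_upwards [eventually_gt_atTop 0] with X hX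
  have h4 : (X ^ (1 / 4 : ℝ)) ^ 4 = X := by
    rw [← Real.rpow_natCast, ← Real.rpow_mul hX.le]
    norm_num
  have h5 : DiscCond s (X ^ (1 / 4 : ℝ)) = P X := by
    ext d
    rw [hP, DiscCond, h4]
  simp only [Function.comp_apply, h4, h5]
  field_simp

/-- Davenport's theorem on class numbers of binary cubic forms: as `X → ∞`,
`N(V⁺; X) = (π²/72) X + o(X)` and `N(V⁻; X) = (π²/24) X + o(X)`. -/
theorem davenport_binary_cubic_form_count :
    Tendsto (fun X : ℝ =>
      (NV (fun d => 0 < (d : ℝ) ∧ (d : ℝ) < X) - Real.pi ^ 2 / 72 * X) / X) atTop (𝓝 0) ∧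
    Tendsto (fun X : ℝ =>
      (NV (fun d => -X < (d : ℝ) ∧ (d : ℝ) < 0) - Real.pi ^ 2 / 24 * X) / X) atTop (𝓝 0) := by
  constructor
  · refine tendsto_NV_sub true (P := fun X d => 0 < (d : ℝ) ∧ (d : ℝ) < X) (fun X d => ?_) ?_
    · simp only [cS]
      constructor
      · rintro ⟨h1, h2⟩
        exact ⟨by linarith, by rwa [abs_of_pos h1]⟩
      · rintro ⟨h1, h2⟩
        exact ⟨by linarith, (le_abs_self _).trans_lt h2⟩
    · simp only [volConst, cS, cJ]
      norm_num
      ring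
  · refine tendsto_NV_sub false (P := fun X d => -X < (d : ℝ) ∧ (d : ℝ) < 0) (fun X d => ?_) ?_
    · simp only [cS]
      constructor
      · rintro ⟨h1, h2⟩
        exact ⟨by linarith, by rw [abs_of_neg h2]; linarith⟩
      · rintro ⟨h1, h2⟩
        exact ⟨(abs_lt.1 h2).1, by linarith⟩
    · simp only [volConst, cS, cJ]
      norm_num
      ring
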